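/- arXiv:1712.03180 — 3 statements merged into one kernel-verified Lean document; each statement's English description precedes it below -/
import Mathlib

section
/- Let Z = lim←(Z₁ ←p₁ Z₂ ←p₂ ···) be an inverse limit with a cover ℱ_i of each Z_i satisfying: (A) each Z_i is a complete metric space; (B) each bonding map p_i: Z_{i+1} → Z_i is surjective and 1-Lipschitz; (C) each ℱ_i is either an open cover or a closed, locally finite, locally finite-dimensional cover; (D) each pull-back p_i^{-1}(ℱ_i) is an AE(n)-cover; (E) Σ_i mesh ℱ_i < ∞. Let X be an at most n-dimensional metric space, f: X → Z₁ a continuous map, A a closed subset of X, and g₀: A → Z a continuous map with π₁ ∘ g₀ = f|_A, where π₁: Z → Z₁ is the long projection. Then there exists a continuous map g: X → Z with g|_A = g₀. -/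
open Set Metric unitInterval
open scoped ENNReal Classical

noncomputable section

/-! ### Basic extension-theoretic notions -/

/-- A topological space has covering dimension `< n` (order of refinements at most `n`):
every open cover admits an open refinement in which every point belongs to
at most `n` members. -/
def CovDimLT (X : Type*) [TopologicalSpace X] (n : ℕ) : Prop :=
  ∀ U : Set (Set X), (∀ u ∈ U, IsOpen u) → ⋃₀ U = univ →
    ∃ R : Set (Set X), (∀ r ∈ R, IsOpen r) ∧ ⋃₀ R = univ ∧
      (∀ r ∈ R, ∃ u ∈ U, r ⊆ u) ∧
      ∀ x : X, {r ∈ R | x ∈ r}.Finite ∧ {r ∈ R | x ∈ r}.ncard ≤ n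

/-- Lebesgue covering dimension at most `n`. -/
def CovDimLE (X : Type*) [TopologicalSpace X] (n : ℕ) : Prop :=
  CovDimLT X (n + 1)

/-- `X` is an absolute extensor in dimension `n` (an `AE(n)`): every continuous map into `X`
from a closed subset of an at most `n`-dimensional metric space `Y` extends continuously
over all of `Y`. -/
def IsAE.{u, v} (n : ℕ) (X : Type v) [TopologicalSpace X] : Prop :=
  ∀ (Y : Type u) [MetricSpace Y], CovDimLE Y n →
    ∀ A : Set Y, IsClosed A → ∀ f : C(A, X),
      ∃ g : C(Y, X), ∀ a : A, g ↑a = f a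

/-- `X` is an absolute neighborhood extensor in dimension `n` (an `ANE(n)`): every continuous
map into `X` from a closed subset `A` of an at most `n`-dimensional metric space extends
continuously over some open neighborhood of `A`. -/
def IsANE.{u, v} (n : ℕ) (X : Type v) [TopologicalSpace X] : Prop :=
  ∀ (Y : Type u) [MetricSpace Y], CovDimLE Y n →
    ∀ A : Set Y, IsClosed A → ∀ f : C(A, X),
      ∃ (U : Set Y) (_ : IsOpen U) (hAU : A ⊆ U) (g : C(U, X)),
        ∀ (a : Y) (ha : a ∈ A), g ⟨a, hAU ha⟩ = f ⟨a, ha⟩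

/-- `X` is an `ANE(∞)`: an absolute neighborhood extensor for the class of all metric
spaces (no dimension restriction). -/
def IsANEInf.{u, v} (X : Type v) [TopologicalSpace X] : Prop :=
  ∀ (Y : Type u) [MetricSpace Y],
    ∀ A : Set Y, IsClosed A → ∀ f : C(A, X),
      ∃ (U : Set Y) (_ : IsOpen U) (hAU : A ⊆ U) (g : C(U, X)),
        ∀ (a : Y) (ha : a ∈ A), g ⟨a, hAU ha⟩ = f ⟨a, ha⟩

/-! ### Covers -/

/-- An (indexed) family is a cover when its union is everything. -/
def IsCover {ι X : Type*} (F : ι → Set X) : Prop :=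
  (⋃ i, F i) = univ

/-- A cover is an `AE(n)`-cover if the intersection of every (nonempty) subfamily is either
empty or an absolute extensor in dimension `n`. -/
def IsAECover.{u, v, w} (n : ℕ) {ι : Type v} {X : Type w} [TopologicalSpace X]
    (F : ι → Set X) : Prop :=
  IsCover F ∧ ∀ A : Set ι, A.Nonempty →
    (⋂ i ∈ A, F i) = ∅ ∨ IsAE.{u} n (⋂ i ∈ A, F i)

/-- Two covers with the same indexing set are isomorphic if corresponding subfamilies
have nonempty intersections simultaneously. -/
def CoversIsomorphic {ι X Y : Type*} (F : ι → Set X) (G : ι → Set Y) : Prop :=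
  ∀ J : Set ι, (⋂ i ∈ J, F i).Nonempty ↔ (⋂ i ∈ J, G i).Nonempty

/-- A cover is locally finite-dimensional if its nerve is a locally finite-dimensional
simplicial complex: every vertex belongs to simplices of bounded dimension only. -/
def LocallyFinDimCover {ι X : Type*} (F : ι → Set X) : Prop :=
  ∀ i : ι, ∃ N : ℕ, ∀ A : Finset ι, i ∈ A → (⋂ j ∈ A, F j).Nonempty → A.card ≤ N

/-- Two maps are `F`-close when each pair of corresponding values lies in a common
element of `F`. -/
def CoverClose {ι X Y : Type*} (F : ι → Set Y) (f g : X → Y) : Prop :=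
  ∀ x : X, ∃ i : ι, f x ∈ F i ∧ g x ∈ F i

/-- Two maps are `F`-homotopic when they are joined by a homotopy each of whose paths
lies in a single element of `F`. -/
def CoverHomotopic {ι X Y : Type*} [TopologicalSpace X] [TopologicalSpace Y]
    (F : ι → Set Y) (f g : C(X, Y)) : Prop :=
  ∃ H : f.Homotopy g, ∀ x : X, ∃ i : ι, ∀ t : unitInterval, H (t, x) ∈ F i

/-- The mesh of a cover: the supremum of the diameters of its elements. -/
def coverMesh {ι X : Type*} [PseudoEMetricSpace X] (F : ι → Set X) : ℝ≥0∞ :=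
  ⨆ i, EMetric.diam (F i)

/-! ### Homotopy-theoretic notions -/

/-- The function induced by a continuous map on homotopy groups (of index type `N`). -/
def HomotopyGroup.inducedMap {X Y : Type*} [TopologicalSpace X] [TopologicalSpace Y]
    (f : C(X, Y)) (N : Type*) (x : X) :
    HomotopyGroup N X x → HomotopyGroup N Y (f x) :=
  Quotient.map
    (fun g => ⟨f.comp g.1, fun y hy => by
      simp only [ContinuousMap.comp_apply]
      rw [g.2 y hy]⟩)
    (fun g h H => H.elim fun H => ⟨H.compContinuousMap f⟩)

/-- A continuous map is a weak `n`-homotopy equivalence if it induces isomorphisms on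
homotopy groups in all dimensions `< n`, regardless of the choice of basepoint. -/
def IsWeakNHomotopyEquiv {X Y : Type*} [TopologicalSpace X] [TopologicalSpace Y]
    (n : ℕ) (f : C(X, Y)) : Prop :=
  ∀ k < n, ∀ x : X, Function.Bijective (HomotopyGroup.inducedMap f (Fin k) x)

/-- `X` has vanishing homotopy groups in all dimensions `< n`, for every basepoint. -/
def VanishingHomotopyBelow (n : ℕ) (X : Type*) [TopologicalSpace X] : Prop :=
  ∀ k < n, ∀ x : X, Subsingleton (HomotopyGroup (Fin k) X x)

/-- `f` is null-homotopic inside the subset `U`: there is a homotopy, with values in `U`,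
from `f` to a constant map. -/
def NullHomotopicIn {S X : Type*} [TopologicalSpace S] [TopologicalSpace X]
    (f : C(S, X)) (U : Set X) : Prop :=
  ∃ (H : C(S × unitInterval, X)) (c : X),
    (∀ s : S, H (s, 0) = f s) ∧ (∀ s : S, H (s, 1) = c) ∧ ∀ z, H z ∈ U

/-- `X` is locally `k`-connected: every neighborhood `U` of a point contains a
neighborhood `V` of the point such that every map of the `k`-sphere into `V` is
null-homotopic in `U`. -/
def LocallyKConnected (k : ℕ) (X : Type*) [TopologicalSpace X] : Prop :=
  ∀ (x : X) (U : Set X), IsOpen U → x ∈ U →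
    ∃ V : Set X, IsOpen V ∧ x ∈ V ∧
      ∀ f : C(Metric.sphere (0 : EuclideanSpace ℝ (Fin (k + 1))) 1, X),
        (∀ s, f s ∈ V) → NullHomotopicIn f U

/-- `A` is a deformation retract of `B` (both subsets of an ambient space `X`). -/
def IsDeformationRetractOf {X : Type*} [TopologicalSpace X] (A B : Set X) : Prop :=
  A ⊆ B ∧ ∃ H : C(B × unitInterval, X),
    (∀ b : B, H (b, 0) = ↑b) ∧ (∀ b : B, H (b, 1) ∈ A) ∧
    (∀ (b : B) (t : unitInterval), H (b, t) ∈ B) ∧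
    ∀ b : B, (b : X) ∈ A → H (b, 1) = ↑b

/-! ### Simplicial complexes and their metric realizations -/

/-- An abstract simplicial complex on a vertex type `V`. -/
structure SComplex (V : Type*) where
  faces : Set (Finset V)
  nonempty_of_mem : ∀ s ∈ faces, s.Nonempty
  down_closed : ∀ s ∈ faces, ∀ t : Finset V, t ⊆ s → t.Nonempty → t ∈ faces

namespace SComplex

variable {V W : Type*}

/-- The geometric realization with scale `κ` of a simplicial complex, i.e. the polyhedron,
as a subset of `ℓ¹(V)`: nonnegative functions supported on a simplex whose coordinates sum
to `κ` (each vertex `v` is the point `κ·e_v`).  It carries the metric topology induced from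
the `ℓ¹`-norm. -/
def space (K : SComplex V) (κ : ℝ) : Set (lp (fun _ : V => ℝ) 1) :=
  {x | (∀ v, 0 ≤ x v) ∧ (∃ s ∈ K.faces, ∀ v, x v ≠ 0 → v ∈ s) ∧
    HasSum (fun v => x v) κ}

/-- The closed geometric simplex of the realization spanned by a face `s`. -/
def cell (K : SComplex V) (κ : ℝ) (s : Finset V) : Set (K.space κ) :=
  {x | ∀ v, (x : lp (fun _ : V => ℝ) 1) v ≠ 0 → v ∈ s}

/-- The simplices of the barycentric subdivision `βK` are the nonempty finite chains
of faces of `K`. -/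
def IsChainOfFaces (K : SComplex V) (c : Finset (Finset V)) : Prop :=
  c.Nonempty ∧ (∀ s ∈ c, s ∈ K.faces) ∧ ∀ s₁ ∈ c, ∀ s₂ ∈ c, s₁ ⊆ s₂ ∨ s₂ ⊆ s₁

/-- The closed geometric simplex of the barycentric subdivision `βK` spanned by the chain
`c`, viewed inside the realization of `K`: the convex hull of the barycenters of the
faces in `c`. -/
def chainCell (K : SComplex V) (κ : ℝ) (c : Finset (Finset V)) : Set (K.space κ) :=
  {y | ∃ t : Finset V → ℝ, (∀ s, 0 ≤ t s) ∧ (∀ s, t s ≠ 0 → s ∈ c) ∧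
      (∑ s ∈ c, t s) = κ ∧
      ∀ w, (y : lp (fun _ : V => ℝ) 1) w =
        ∑ s ∈ c, (if w ∈ s then t s / (s.card : ℝ) else 0)}

/-- A set of faces forms a subcomplex of `K`. -/
def IsSubcomplex (K : SComplex V) (F : Set (Finset V)) : Prop :=
  F ⊆ K.faces ∧ ∀ s ∈ F, ∀ t : Finset V, t ⊆ s → t.Nonempty → t ∈ F

/-- The point set of the subcomplex with faces `F`, inside the realization of `K`. -/
def subSpace (K : SComplex V) (κ : ℝ) (F : Set (Finset V)) : Set (K.space κ) :=
  {x | ∃ s ∈ F, ∀ v, (x : lp (fun _ : V => ℝ) 1) v ≠ 0 → v ∈ s}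

/-- The barycentric star of a subcomplex `F` in `K`: the union of the simplices of the
barycentric subdivision `βK` that intersect the subcomplex. -/
def bst (K : SComplex V) (κ : ℝ) (F : Set (Finset V)) : Set (K.space κ) :=
  ⋃ c ∈ {c | K.IsChainOfFaces c ∧ (K.chainCell κ c ∩ K.subSpace κ F).Nonempty},
    K.chainCell κ c

/-- The open star of a subcomplex `F` in `K`: the complement of the union of all
simplices of `K` that do not intersect the subcomplex. -/
def ost (K : SComplex V) (κ : ℝ) (F : Set (Finset V)) : Set (K.space κ) :=
  (⋃ s ∈ {s | s ∈ K.faces ∧ K.cell κ s ∩ K.subSpace κ F = ∅}, K.cell κ s)ᶜ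

/-- The open star of a subcomplex `F` taken in the barycentric subdivision `βK`:
the complement of the union of all simplices of `βK` that do not intersect the
subcomplex. -/
def ostBsd (K : SComplex V) (κ : ℝ) (F : Set (Finset V)) : Set (K.space κ) :=
  (⋃ c ∈ {c | K.IsChainOfFaces c ∧ K.chainCell κ c ∩ K.subSpace κ F = ∅},
    K.chainCell κ c)ᶜ

/-- Barycentric star of a vertex. -/
def bstVertex (K : SComplex V) (κ : ℝ) (v : V) : Set (K.space κ) :=
  K.bst κ {({v} : Finset V)}

/-- Open star of a vertex. -/
def ostVertex (K : SComplex V) (κ : ℝ) (v : V) : Set (K.space κ) :=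
  K.ost κ {({v} : Finset V)}

/-- A simplicial complex is locally finite-dimensional if the simplices containing any
given vertex have bounded dimension. -/
def LocallyFiniteDimensional (K : SComplex V) : Prop :=
  ∀ v : V, {v} ∈ K.faces → ∃ N : ℕ, ∀ s ∈ K.faces, v ∈ s → s.card ≤ N

/-- `p` is a simplicial map of the realizations (scales `κ`, `lam`): it is induced by a
vertex map `φ` carrying faces onto faces, extended affinely on each simplex. -/
def IsSimplicialMap (K : SComplex V) (L : SComplex W) (κ lam : ℝ)
    (p : K.space κ → L.space lam) : Prop :=
  ∃ φ : V → W,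
    (∀ s ∈ K.faces, ∃ t ∈ L.faces,
      (∀ v ∈ s, φ v ∈ t) ∧ ∀ w ∈ t, ∃ v ∈ s, φ v = w) ∧
    ∀ (x : K.space κ) (w : W),
      (p x : lp (fun _ : W => ℝ) 1) w =
        (lam / κ) * ∑' v : V, (if φ v = w then (x : lp (fun _ : V => ℝ) 1) v else 0)

/-- `p` is quasi-simplicial: it is simplicial as a map into the barycentric subdivision
`βL`, i.e. induced by a vertex map `φ` from vertices of `K` to faces of `L` (the vertices
of `βL`) carrying each face of `K` into a chain, extended affinely; the formula is the
composition of the simplicial extension with the canonical identification `|βL| = |L|`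
sending the vertex `s` of `βL` to the barycenter of `s`. -/
def IsQuasiSimplicialMap (K : SComplex V) (L : SComplex W) (κ lam : ℝ)
    (p : K.space κ → L.space lam) : Prop :=
  ∃ φ : V → Finset W,
    (∀ v : V, ({v} : Finset V) ∈ K.faces → φ v ∈ L.faces) ∧
    (∀ s ∈ K.faces, ∀ v₁ ∈ s, ∀ v₂ ∈ s, φ v₁ ⊆ φ v₂ ∨ φ v₂ ⊆ φ v₁) ∧
    ∀ (x : K.space κ) (w : W),
      (p x : lp (fun _ : W => ℝ) 1) w =
        (lam / κ) *
          ∑' v : V, (if w ∈ φ v then (x : lp (fun _ : V => ℝ) 1) v / ((φ v).card : ℝ)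
            else 0)

/-- A quasi-simplicial map is `n`-regular if the preimage of every (closed) simplex of
the barycentric subdivision `βL` has vanishing homotopy groups in dimensions `< n`,
regardless of basepoint. -/
def IsNRegularMap (n : ℕ) (K : SComplex V) (L : SComplex W) (κ lam : ℝ)
    (p : K.space κ → L.space lam) : Prop :=
  IsQuasiSimplicialMap K L κ lam p ∧
    ∀ c : Finset (Finset W), L.IsChainOfFaces c →
      VanishingHomotopyBelow n (p ⁻¹' (L.chainCell lam c))

end SComplex

/-! ### Inverse limits -/

/-- The long projection of an inverse limit (realized as the subspace of the product
consisting of all threads) onto its `i`-th coordinate space. -/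
def invLimProj {Z : ℕ → Type*} [∀ i, TopologicalSpace (Z i)]
    (p : ∀ i, C(Z (i + 1), Z i)) (i : ℕ) :
    C({x : ∀ j, Z j // ∀ j, p j (x (j + 1)) = x j}, Z i) :=
  ⟨fun x => x.1 i, (continuous_apply i).comp continuous_subtype_val⟩

/-- The short projections of an inverse sequence: `shortProj p i m : Z (i + m) → Z i`. -/
def shortProj {Z : ℕ → Type*} [∀ i, TopologicalSpace (Z i)]
    (p : ∀ i, C(Z (i + 1), Z i)) (i : ℕ) : ∀ m : ℕ, C(Z (i + m), Z i)
  | 0 => ContinuousMap.id _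
  | m + 1 => (shortProj p i m).comp (p (i + m))

end

universe u

namespace LiftAux

theorem covDimLE_of_inducing {Q : Type*} [TopologicalSpace Q] (n : ℕ) (e : Q → (Fin n → ℝ))
    (he : Topology.IsInducing e) (hK : IsCompact (range e)) : CovDimLE Q n := by
  intro U hUo hUc
  have h1 : ∀ u : U, ∃ O : Set (Fin n → ℝ), IsOpen O ∧ e ⁻¹' O = u.1 := fun u =>
    he.isOpen_iff.1 (hUo u.1 u.2)
  choose O hO hOe using h1
  have h2 : range e ⊆ ⋃ u, O u := by
    rintro _ ⟨q, rfl⟩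
    have : q ∈ ⋃₀ U := by rw [hUc]; trivial
    obtain ⟨u, hu, hq⟩ := this
    refine mem_iUnion.2 ⟨⟨u, hu⟩, ?_⟩
    have : q ∈ e ⁻¹' O ⟨u, hu⟩ := by rw [hOe]; exact hq
    exact this
  obtain ⟨δ, hδ, hL⟩ := lebesgue_number_lemma_of_metric hK hO h2
  let D : Fin (n+1) → (Fin n → ℤ) → Set Q := fun c m =>
    {q | ∀ i, (m i : ℝ) < e q i / δ - (c : ℝ) / (n+1) ∧ e q i / δ - (c : ℝ) / (n+1) < m i + 1}
  have hDo : ∀ c m, IsOpen (D c m) := by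
    intro c m
    have hc := he.continuous
    have : D c m = ⋂ i, {q | (m i : ℝ) < e q i / δ - (c : ℝ) / (n+1) ∧ e q i / δ - (c : ℝ) / (n+1) < m i + 1} := by
      ext q; simp [D]
    rw [this]
    refine isOpen_iInter_of_finite fun i => ?_
    have hci : Continuous fun q => e q i := (continuous_apply i).comp hc
    have h1 : Continuous fun q => e q i / δ - (c : ℝ) / (n+1) := by fun_prop
    exact (isOpen_lt continuous_const h1).inter (isOpen_lt h1 continuous_const)
  refine ⟨{r | r.Nonempty ∧ ∃ c m, r = D c m}, ?_, ?_, ?_, ?_⟩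
  · rintro r ⟨-, c, m, rfl⟩; exact hDo c m
  · refine eq_univ_of_forall fun q => ?_
    have : ∃ c : Fin (n+1), ∀ i, ∀ k : ℤ, e q i / δ - (c : ℝ) / (n+1) ≠ k := by
      by_contra hcon
      push Not at hcon
      choose i k hk using hcon
      obtain ⟨c, c', hne, hii⟩ := Fintype.exists_ne_map_eq_of_card_lt i (by simp)
      have h1 := hk c
      have h2 := hk c'
      rw [hii] at h1
      have hn : (0:ℝ) < n + 1 := by positivity
      have h3 : ((c' : ℝ) - c) = (k c - k c') * (n+1) := by
        field_simp at h1 h2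
        have : (δ:ℝ) ≠ 0 := hδ.ne'
        have h4 : δ * ((c' : ℝ) - c) = δ * ((k c - k c') * (n+1)) := by linarith
        exact mul_left_cancel₀ this h4
      have h4 : ((c' : ℤ) - (c : ℤ)) = (k c - k c') * ((n:ℤ)+1) := by exact_mod_cast h3
      have hc := c.2
      have hc' := c'.2
      have hne' : (c : ℕ) ≠ c' := fun h => hne (Fin.ext h)
      have h6 : (k c - k c') = 0 := by
        by_contra h0
        rcases lt_or_gt_of_ne h0 with h | h
        · nlinarith
        · nlinarith
      rw [h6] at h4
      omega
    obtain ⟨c, hc⟩ := this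
    have hq : q ∈ D c (fun i => ⌊e q i / δ - (c : ℝ) / (n+1)⌋) := fun i =>
      ⟨lt_of_le_of_ne (Int.floor_le _) (hc i _).symm, Int.lt_floor_add_one _⟩
    exact ⟨_, ⟨⟨q, hq⟩, _, _, rfl⟩, hq⟩
  · rintro r ⟨⟨q, hq⟩, c, m, rfl⟩
    obtain ⟨u, hu⟩ := hL (e q) ⟨q, rfl⟩
    refine ⟨u.1, u.2, fun q' hq' => ?_⟩
    rw [← hOe u]
    apply hu
    rw [mem_ball, dist_pi_lt_iff hδ]
    intro i
    have h1 := hq i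
    have h2 := hq' i
    have h3 : |e q' i / δ - e q i / δ| < 1 := by
      rw [abs_lt]; constructor <;> linarith [h1.1, h1.2, h2.1, h2.2]
    rw [← sub_div, abs_div, abs_of_pos hδ, div_lt_one hδ] at h3
    exact h3
  · intro q
    have hsub : {r ∈ {r | r.Nonempty ∧ ∃ c m, r = D c m} | q ∈ r} ⊆
        range (fun c : Fin (n+1) => D c (fun i => ⌊e q i / δ - (c : ℝ) / (n+1)⌋)) := by
      rintro r ⟨⟨-, c, m, rfl⟩, hq⟩
      refine ⟨c, ?_⟩
      refine congrArg (D c) ?_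
      funext i
      exact Int.floor_eq_iff.2 ⟨(hq i).1.le, (hq i).2⟩
    have hf := finite_range (fun c : Fin (n+1) => D c (fun i => ⌊e q i / δ - (c : ℝ) / (n+1)⌋))
    refine ⟨hf.subset hsub, (ncard_le_ncard hsub hf).trans ?_⟩
    rw [← image_univ]
    exact (ncard_image_le finite_univ).trans (by simp [ncard_univ])

theorem covDimLE_closed {X : Type*} [TopologicalSpace X] {n : ℕ} (h : CovDimLE X n)
    {C : Set X} (hC : IsClosed C) : CovDimLE C n := by
  intro U hUo hUc
  obtain ⟨R, hRo, hRc, hRr, hR⟩ := h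
    {o | IsOpen o ∧ ((Subtype.val ⁻¹' o : Set C) = ∅ ∨ ∃ u ∈ U, (Subtype.val ⁻¹' o : Set C) ⊆ u)}
    (fun o ho => ho.1) (by
      refine eq_univ_of_forall fun x => ?_
      by_cases hx : x ∈ C
      · have : (⟨x, hx⟩ : C) ∈ ⋃₀ U := by rw [hUc]; trivial
        obtain ⟨u, hu, hxu⟩ := this
        obtain ⟨o, ho, rfl⟩ := isOpen_induced_iff.1 (hUo u hu)
        exact ⟨o, ⟨ho, Or.inr ⟨_, hu, subset_rfl⟩⟩, hxu⟩
      · refine ⟨Cᶜ, ⟨hC.isOpen_compl, Or.inl ?_⟩, hx⟩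
        ext y; simp)
  refine ⟨{r' | r'.Nonempty ∧ ∃ r ∈ R, r' = Subtype.val ⁻¹' r}, ?_, ?_, ?_, ?_⟩
  · rintro r' ⟨-, r, hr, rfl⟩; exact (hRo r hr).preimage continuous_subtype_val
  · refine eq_univ_of_forall fun x => ?_
    have : x.1 ∈ ⋃₀ R := by rw [hRc]; trivial
    obtain ⟨r, hr, hx⟩ := this
    exact ⟨_, ⟨⟨x, hx⟩, r, hr, rfl⟩, hx⟩
  · rintro r' ⟨hne, r, hr, rfl⟩
    obtain ⟨o, ⟨-, ho⟩, hro⟩ := hRr r hr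
    rcases ho with ho | ⟨u, hu, hou⟩
    · obtain ⟨x, hx⟩ := hne
      have : x ∈ (Subtype.val ⁻¹' o : Set C) := hro hx
      rw [ho] at this; exact this.elim
    · exact ⟨u, hu, fun x hx => hou (hro hx)⟩
  · intro x
    have hsub : {r ∈ {r' : Set C | r'.Nonempty ∧ ∃ r ∈ R, r' = Subtype.val ⁻¹' r} | x ∈ r} ⊆
        (fun r => (Subtype.val ⁻¹' r : Set C)) '' {r ∈ R | x.1 ∈ r} := by
      rintro r' ⟨⟨-, r, hr, rfl⟩, hx⟩
      exact ⟨r, ⟨hr, hx⟩, rfl⟩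
    have hf := ((hR x.1).1.image (fun r => (Subtype.val ⁻¹' r : Set C)))
    exact ⟨hf.subset hsub, (ncard_le_ncard hsub hf).trans ((ncard_image_le (hR x.1).1).trans (hR x.1).2)⟩

theorem indexed_refine {X : Type*} [TopologicalSpace X] {n : ℕ} (h : CovDimLE X n)
    {ι : Type*} (U : ι → Set X) (hU : ∀ i, IsOpen (U i)) (hc : ⋃ i, U i = univ) :
    ∃ V : ι → Set X, (∀ i, IsOpen (V i)) ∧ (∀ i, V i ⊆ U i) ∧ (⋃ i, V i = univ) ∧
      ∀ x, {i | x ∈ V i}.Finite ∧ {i | x ∈ V i}.ncard ≤ n + 1 := by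
  obtain ⟨R, hRo, hRc, hRr, hR⟩ := h (range U) (by rintro _ ⟨i, rfl⟩; exact hU i) (by simpa using hc)
  have : ∀ r : R, ∃ i, r.1 ⊆ U i := by
    rintro ⟨r, hr⟩
    obtain ⟨_, ⟨i, rfl⟩, hi⟩ := hRr r hr
    exact ⟨i, hi⟩
  choose j hj using this
  refine ⟨fun i => ⋃ r : {r : R // j r = i}, r.1.1, ?_, ?_, ?_, ?_⟩
  · intro i; exact isOpen_iUnion fun r => hRo _ r.1.2
  · intro i; refine iUnion_subset ?_; rintro ⟨r, rfl⟩; exact hj r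
  · refine eq_univ_of_forall fun x => ?_
    have : x ∈ ⋃₀ R := by rw [hRc]; trivial
    obtain ⟨r, hr, hx⟩ := this
    exact mem_iUnion.2 ⟨j ⟨r, hr⟩, mem_iUnion.2 ⟨⟨⟨r, hr⟩, rfl⟩, hx⟩⟩
  · intro x
    let j' : Set X → ι := fun r => if h : r ∈ R then j ⟨r, h⟩ else
      j ⟨_, (mem_sUnion.1 (show x ∈ ⋃₀ R by rw [hRc]; trivial)).choose_spec.1⟩
    have hsub : {i | x ∈ ⋃ r : {r : R // j r = i}, r.1.1} ⊆ j' '' {r ∈ R | x ∈ r} := by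
      intro i hi
      obtain ⟨⟨⟨r, hr⟩, rfl⟩, hx⟩ := mem_iUnion.1 hi
      exact ⟨r, ⟨hr, hx⟩, by simp [j', hr]⟩
    have hf := (hR x).1.image j'
    exact ⟨hf.subset hsub, (ncard_le_ncard hsub hf).trans ((ncard_image_le (hR x).1).trans (hR x).2)⟩

theorem refine_on_closed {X : Type*} [TopologicalSpace X] {n : ℕ} (h : CovDimLE X n)
    {ι : Type*} (U : ι → Set X) (hU : ∀ i, IsOpen (U i)) (L : Set X) (hL : IsClosed L)
    (hc : L ⊆ ⋃ i, U i) :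
    ∃ V : ι → Set X, (∀ i, IsOpen (V i)) ∧ (∀ i, V i ⊆ U i) ∧ (∀ i, U i \ L ⊆ V i) ∧
      (⋃ i, V i = ⋃ i, U i) ∧
      ∀ x ∈ L, {i | x ∈ V i}.Finite ∧ {i | x ∈ V i}.ncard ≤ n + 1 := by
  obtain ⟨G, hGo, hGU, hGc, hG⟩ := indexed_refine h (fun o : Option ι => o.elim Lᶜ U)
    (by rintro (_ | i); exacts [hL.isOpen_compl, hU i])
    (by
      refine eq_univ_of_forall fun x => ?_
      by_cases hx : x ∈ L
      · obtain ⟨i, hi⟩ := mem_iUnion.1 (hc hx)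
        exact mem_iUnion.2 ⟨some i, hi⟩
      · exact mem_iUnion.2 ⟨none, hx⟩)
  have hVU : ∀ i, (U i \ L) ∪ G (some i) ⊆ U i := fun i =>
    union_subset sdiff_subset (hGU (some i))
  refine ⟨fun i => (U i \ L) ∪ G (some i), fun i => ((hU i).sdiff hL).union (hGo _), hVU,
    fun i => subset_union_left, ?_, ?_⟩
  · refine subset_antisymm (iUnion_mono hVU) ?_
    intro x hx
    by_cases hxL : x ∈ L
    · have : x ∈ ⋃ i, G i := by rw [hGc]; trivial
      obtain ⟨o, ho⟩ := mem_iUnion.1 this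
      cases o with
      | none => exact absurd hxL (hGU none ho)
      | some i => exact mem_iUnion.2 ⟨i, Or.inr ho⟩
    · obtain ⟨i, hi⟩ := mem_iUnion.1 hx
      exact mem_iUnion.2 ⟨i, Or.inl ⟨hi, hxL⟩⟩
  · intro x hx
    have hsub : some '' {i | x ∈ (U i \ L) ∪ G (some i)} ⊆ {o | x ∈ G o} := by
      rintro _ ⟨i, hi, rfl⟩
      rcases hi with hi | hi
      · exact absurd hx hi.2
      · exact hi
    have hf := (hG x).1.subset hsub
    refine ⟨hf.of_finite_image (Option.some_injective ι).injOn, ?_⟩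
    rw [← ncard_image_of_injective _ (Option.some_injective ι)]
    exact (ncard_le_ncard hsub (hG x).1).trans (hG x).2

theorem refine_open {Y : Type*} [MetricSpace Y] {n : ℕ} (h : CovDimLE Y n)
    (A : Set Y) (hA : IsClosed A) (hne : A.Nonempty)
    {ι : Type*} (U : ι → Set Y) (hU : ∀ i, IsOpen (U i)) (hc : ⋃ i, U i = Aᶜ) :
    ∃ V : ι → Set Y, (∀ i, IsOpen (V i)) ∧ (∀ i, V i ⊆ U i) ∧ (⋃ i, V i = Aᶜ) ∧
      ∀ x ∈ Aᶜ, {i | x ∈ V i}.Finite ∧ {i | x ∈ V i}.ncard ≤ n + 1 := by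
  let d : Y → ℝ := fun y => infDist y A
  have hd : Continuous d := continuous_infDist_pt A
  have hd0 : ∀ y, y ∉ A → 0 < d y := fun y hy => (hA.notMem_iff_infDist_pos hne).1 hy
  have hd0' : ∀ y, 0 < d y → y ∉ A := fun y hy => (hA.notMem_iff_infDist_pos hne).2 hy
  let L : ℕ → Set Y := fun k => {y | k * d y ≤ 1 ∧ 1 ≤ (k + 1) * d y}
  have hL : ∀ k, IsClosed (L k) := fun k => by
    have h1 : Continuous fun y => (k:ℝ) * d y := by fun_prop
    have h2 : Continuous fun y => ((k:ℝ) + 1) * d y := by fun_prop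
    exact (isClosed_le h1 continuous_const).inter (isClosed_le continuous_const h2)
  have hLA : ∀ k, L k ⊆ Aᶜ := fun k y hy => hd0' y (by
    by_contra h0
    have : (k + 1) * d y ≤ 0 := mul_nonpos_of_nonneg_of_nonpos (by positivity) (not_lt.1 h0)
    linarith [hy.2])
  let P := {V : ι → Set Y // (∀ i, IsOpen (V i)) ∧ ⋃ i, V i = Aᶜ}
  have step : ∀ k (V : P), ∃ V' : P, (∀ i, V'.1 i ⊆ V.1 i) ∧ (∀ i, V.1 i \ L k ⊆ V'.1 i) ∧
      ∀ x ∈ L k, {i | x ∈ V'.1 i}.Finite ∧ {i | x ∈ V'.1 i}.ncard ≤ n + 1 := by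
    rintro k ⟨V, hVo, hVc⟩
    obtain ⟨V', h1, h2, h3, h4, h5⟩ := refine_on_closed h V hVo (L k) (hL k) (by rw [hVc]; exact hLA k)
    exact ⟨⟨V', h1, h4.trans hVc⟩, h2, h3, h5⟩
  choose S hS1 hS2 hS3 using step
  let W : ℕ → P := fun k => Nat.rec ⟨U, hU, hc⟩ (fun k V => S k V) k
  have hW : ∀ k, W (k+1) = S k (W k) := fun k => rfl
  have hanti : ∀ i, Antitone fun k => (W k).1 i := fun i =>
    antitone_nat_of_succ_le fun k => by
      show (W (k+1)).1 i ⊆ (W k).1 i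
      rw [hW]; exact hS1 k _ i
  have key : ∀ (N : ℕ) i x, 1 < N * d x → x ∈ (W N).1 i → ∀ k, x ∈ (W k).1 i := by
    intro N i x hx hxN k
    rcases le_total k N with hk | hk
    · exact hanti i hk hxN
    · induction k, hk using Nat.le_induction with
      | base => exact hxN
      | succ k hk ih =>
        rw [hW]
        refine hS2 k _ i ⟨ih, fun hxk => ?_⟩
        have h1 : (0:ℝ) ≤ d x := infDist_nonneg
        have h2 : (N:ℝ) ≤ k := by exact_mod_cast hk
        have := hxk.1
        nlinarith
  have exN : ∀ x ∈ Aᶜ, ∃ N : ℕ, 1 < N * d x := fun x hx => by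
    obtain ⟨N, hN⟩ := exists_nat_gt (1 / d x)
    exact ⟨N, by rwa [div_lt_iff₀ (hd0 x hx)] at hN⟩
  have hsub : ∀ k i, (⋂ k, (W k).1 i) ⊆ (W k).1 i := fun k i => iInter_subset _ k
  refine ⟨fun i => ⋂ k, (W k).1 i, ?_, fun i => hsub 0 i, ?_, ?_⟩
  · intro i
    rw [isOpen_iff_mem_nhds]
    intro x hx
    have hxA : x ∈ Aᶜ := by rw [← hc]; exact mem_iUnion.2 ⟨i, hsub 0 i hx⟩
    obtain ⟨N, hN⟩ := exN x hxA
    have h1 : {y | 1 < N * d y} ∈ nhds x := (isOpen_lt continuous_const (by fun_prop)).mem_nhds hN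
    have h2 : (W N).1 i ∈ nhds x := ((W N).2.1 i).mem_nhds (hsub N i hx)
    filter_upwards [h1, h2] with y hy1 hy2
    exact mem_iInter.2 (key N i y hy1 hy2)
  · refine subset_antisymm ?_ ?_
    · exact (iUnion_mono fun i => hsub 0 i).trans hc.subset
    · intro x hx
      obtain ⟨N, hN⟩ := exN x hx
      have : x ∈ ⋃ i, (W N).1 i := by rw [(W N).2.2]; exact hx
      obtain ⟨i, hi⟩ := mem_iUnion.1 this
      exact mem_iUnion.2 ⟨i, mem_iInter.2 (key N i x hN hi)⟩
  · intro x hx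
    have hpos := hd0 x hx
    have hxL : x ∈ L ⌊1 / d x⌋₊ := by
      constructor
      · rw [← le_div_iff₀ hpos]; exact Nat.floor_le (by positivity)
      · rw [← div_le_iff₀ hpos]; exact (Nat.lt_floor_add_one _).le
    have h1 := hS3 ⌊1 / d x⌋₊ (W ⌊1 / d x⌋₊) x hxL
    rw [← hW] at h1
    have h2 : {i | x ∈ ⋂ k, (W k).1 i} ⊆ {i | x ∈ (W (⌊1 / d x⌋₊+1)).1 i} := fun i hi => hsub (⌊1 / d x⌋₊+1) i hi
    exact ⟨h1.1.subset h2, (ncard_le_ncard h2 h1.1).trans h1.2⟩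
end LiftAux

namespace LiftAux

/-- Controlled extension property for compact subsets of Euclidean space. -/
def ExtP (n : ℕ) {W : Type*} [TopologicalSpace W] (S₁ S₂ : Set W) : Prop :=
  ∀ K B : Set (Fin n → ℝ), IsCompact K → IsClosed B → B ⊆ K → ∀ f : (Fin n → ℝ) → W,
    ContinuousOn f B → MapsTo f B S₁ → ∃ g : (Fin n → ℝ) → W,
      ContinuousOn g K ∧ EqOn g f B ∧ MapsTo g K S₂

theorem extP_of_isAE {n : ℕ} {W : Type*} [TopologicalSpace W] (h : IsAE.{u} n W) :
    ExtP n (univ : Set W) univ := by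
  intro K B hK hB hBK f hf _
  have hdim : CovDimLE (ULift.{u} K) n := by
    refine covDimLE_of_inducing n (fun y => y.down.1) ?_ ?_
    · exact Topology.IsInducing.subtypeVal.comp Homeomorph.ulift.isInducing
    · convert hK
      ext x
      constructor
      · rintro ⟨y, rfl⟩; exact y.down.2
      · intro hx; exact ⟨⟨⟨x, hx⟩⟩, rfl⟩
  have hc : Continuous fun y : ULift.{u} K => y.down.1 :=
    continuous_subtype_val.comp continuous_uliftDown
  obtain ⟨g, hg⟩ := h (ULift.{u} K) hdim {y | y.down.1 ∈ B} (hB.preimage hc)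
    ⟨fun y => f y.1.down.1, hf.comp_continuous (hc.comp continuous_subtype_val) fun y => y.2⟩
  refine ⟨fun x => if hx : x ∈ K then g ⟨⟨x, hx⟩⟩ else f x, ?_, ?_, fun _ _ => trivial⟩
  · rw [continuousOn_iff_continuous_domRestrict]
    have : K.domRestrict (fun x => if hx : x ∈ K then g ⟨⟨x, hx⟩⟩ else f x) =
        fun x : K => g ⟨x⟩ := by
      funext x; simp [Set.domRestrict]
    rw [this]
    exact g.continuous.comp continuous_uliftUp
  · intro x hx
    have hxK := hBK hx
    simp only [hxK, dif_pos]
    exact hg ⟨⟨⟨x, hxK⟩⟩, hx⟩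

theorem isClosed_seq {n : ℕ} (C : ℕ → Set (Fin (n+1) → ℝ)) (hC : ∀ k, IsClosed (C k))
    (hb : ∀ k, ∀ x ∈ C k, (3/4) * (1/2:ℝ)^k ≤ x 0 ∧ ‖x‖ ≤ (5/4) * (1/2:ℝ)^k) :
    IsClosed ({0} ∪ ⋃ k, C k) := by
  refine isClosed_of_closure_subset fun x hx => ?_
  have hcl : IsClosed {x : Fin (n+1) → ℝ | ‖x‖ ≤ 2 * x 0} :=
    isClosed_le continuous_norm (by fun_prop)
  have hsub : ({0} ∪ ⋃ k, C k) ⊆ {x : Fin (n+1) → ℝ | ‖x‖ ≤ 2 * x 0} := by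
    rintro y (hy | hy)
    · rw [mem_singleton_iff] at hy; subst hy; simp
    · obtain ⟨k, hk⟩ := mem_iUnion.1 hy
      have := hb k y hk
      have h2 : (0:ℝ) < (1/2:ℝ)^k := by positivity
      show ‖y‖ ≤ 2 * y 0
      linarith [this.1, this.2]
  have hx1 : ‖x‖ ≤ 2 * x 0 := closure_minimal hsub hcl hx
  rcases eq_or_ne x 0 with h0 | h0
  · exact Or.inl h0
  have hpos : 0 < x 0 := by
    have := norm_pos_iff.2 h0
    linarith
  obtain ⟨N, hN⟩ := exists_pow_lt_of_lt_one (show 0 < x 0 / 2 by positivity) (show (1/2:ℝ) < 1 by norm_num)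
  have hO : IsOpen {y : Fin (n+1) → ℝ | (5/4) * (1/2:ℝ)^N < y 0} :=
    isOpen_lt continuous_const (by fun_prop)
  have hxO : x ∈ {y : Fin (n+1) → ℝ | (5/4) * (1/2:ℝ)^N < y 0} := by
    show (5/4) * (1/2:ℝ)^N < x 0
    linarith
  have hx2 : x ∈ closure ({y : Fin (n+1) → ℝ | (5/4) * (1/2:ℝ)^N < y 0} ∩ ({0} ∪ ⋃ k, C k)) :=
    hO.inter_closure ⟨hxO, hx⟩
  have hfin : IsClosed (⋃ k ∈ Finset.range N, C k) :=
    isClosed_biUnion_finset fun k _ => hC k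
  have hsub2 : ({y : Fin (n+1) → ℝ | (5/4) * (1/2:ℝ)^N < y 0} ∩ ({0} ∪ ⋃ k, C k)) ⊆
      ⋃ k ∈ Finset.range N, C k := by
    rintro y ⟨hy1, hy | hy⟩
    · rw [mem_singleton_iff] at hy; subst hy
      have h2 : (0:ℝ) < (1/2:ℝ)^N := by positivity
      have hy2 : (5/4) * (1/2:ℝ)^N < (0:ℝ) := hy1
      linarith
    · obtain ⟨k, hk⟩ := mem_iUnion.1 hy
      refine mem_iUnion₂.2 ⟨k, ?_, hk⟩
      rw [Finset.mem_range]
      by_contra hkN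
      have h3 : (1/2:ℝ)^k ≤ (1/2:ℝ)^N :=
        pow_le_pow_of_le_one (by norm_num) (by norm_num) (not_lt.1 hkN)
      have h4 := (hb k y hk).2
      have h5 : y 0 ≤ ‖y‖ := (le_abs_self _).trans (norm_le_pi_norm y 0)
      have hy2 : (5/4) * (1/2:ℝ)^N < y 0 := hy1
      linarith
  have := closure_minimal hsub2 hfin hx2
  obtain ⟨k, -, hk⟩ := mem_iUnion₂.1 this
  exact Or.inr (mem_iUnion.2 ⟨k, hk⟩)

theorem local_ext {n : ℕ} {W : Type*} [MetricSpace W] (h : ExtP (n+1) (univ : Set W) univ)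
    (w : W) {ε : ℝ} (hε : 0 < ε) : ∃ δ > 0, ExtP (n+1) (ball w δ) (ball w ε) := by
  by_contra hcon
  push Not at hcon
  have hbad := fun k : ℕ => hcon (1 / ((k:ℝ) + 1)) (by positivity)
  simp only [ExtP] at hbad
  push Not at hbad
  choose K B hK hB hBK f hf hfB hno using hbad
  have hR : ∀ k, ∃ R > 0, ∀ x ∈ K k, ‖x‖ ≤ R := fun k => by
    obtain ⟨R, hR⟩ := (hK k).isBounded.exists_norm_le
    exact ⟨max R 1, by positivity, fun x hx => (hR x hx).trans (le_max_left _ _)⟩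
  choose R hR0 hR using hR
  let c : ℕ → ℝ := fun k => (1/2:ℝ)^k / (4 * R k)
  have hc0 : ∀ k, 0 < c k := fun k => by have := hR0 k; positivity
  let H : ∀ k, (Fin (n+1) → ℝ) → (Fin (n+1) → ℝ) := fun k x i => (1/2:ℝ)^k + c k * x i
  let Jv : ∀ k, (Fin (n+1) → ℝ) → (Fin (n+1) → ℝ) := fun k x i => (x i - (1/2:ℝ)^k) / c k
  have hHc : ∀ k, Continuous (H k) := fun k => by fun_prop
  have hIc : ∀ k, Continuous (Jv k) := fun k => by
    refine continuous_pi fun i => ?_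
    have : Continuous fun x : Fin (n+1) → ℝ => x i := continuous_apply i
    exact (this.sub continuous_const).div_const _
  have hIH : ∀ k x, Jv k (H k x) = x := fun k x => by
    funext i
    have := (hc0 k).ne'
    simp only [Jv, H]; field_simp; ring
  have hest : ∀ k, ∀ x ∈ K k, ∀ i, |H k x i - (1/2:ℝ)^k| ≤ (1/4) * (1/2:ℝ)^k := by
    intro k x hx i
    have h1 : |x i| ≤ R k := (norm_le_pi_norm x i).trans (hR k x hx)
    have h2 : H k x i - (1/2:ℝ)^k = c k * x i := by simp only [H]; ring
    rw [h2, abs_mul, abs_of_pos (hc0 k)]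
    calc c k * |x i| ≤ c k * R k := mul_le_mul_of_nonneg_left h1 (hc0 k).le
      _ = (1/4) * (1/2:ℝ)^k := by
        have := (hR0 k).ne'
        simp only [c]; field_simp
  have hb : ∀ k, ∀ x ∈ H k '' K k, (3/4) * (1/2:ℝ)^k ≤ x 0 ∧ ‖x‖ ≤ (5/4) * (1/2:ℝ)^k := by
    rintro k _ ⟨x, hx, rfl⟩
    have h2 : (0:ℝ) < (1/2:ℝ)^k := by positivity
    constructor
    · have := abs_le.1 (hest k x hx 0)
      linarith [this.1]
    · rw [pi_norm_le_iff_of_nonneg (by positivity)]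
      intro i
      have := abs_le.1 (hest k x hx i)
      rw [Real.norm_eq_abs, abs_le]
      constructor <;> linarith [this.1, this.2]
  have hbB : ∀ k, ∀ x ∈ H k '' B k, (3/4) * (1/2:ℝ)^k ≤ x 0 ∧ ‖x‖ ≤ (5/4) * (1/2:ℝ)^k :=
    fun k x hx => hb k x (image_mono (hBK k) hx)
  have hBc : ∀ k, IsCompact (B k) := fun k => (hK k).of_isClosed_subset (hB k) (hBK k)
  have hMcl := isClosed_seq (fun k => H k '' K k) (fun k => ((hK k).image (hHc k)).isClosed) hb
  have hBcl := isClosed_seq (fun k => H k '' B k) (fun k => ((hBc k).image (hHc k)).isClosed) hbB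
  have hMK : IsCompact ({0} ∪ ⋃ k, H k '' K k) := by
    refine (isCompact_closedBall (0 : Fin (n+1) → ℝ) (5/4)).of_isClosed_subset hMcl ?_
    rintro x (hx | hx)
    · rw [mem_singleton_iff] at hx; subst hx
      rw [mem_closedBall_zero_iff]; norm_num
    · obtain ⟨k, hk⟩ := mem_iUnion.1 hx
      rw [mem_closedBall_zero_iff]
      have h3 : (1/2:ℝ)^k ≤ 1 := pow_le_one₀ (by norm_num) (by norm_num)
      linarith [(hb k x hk).2]
  let O : ℕ → Set (Fin (n+1) → ℝ) := fun k =>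
    {x | (7/10) * (1/2:ℝ)^k < x 0 ∧ x 0 < (13/10) * (1/2:ℝ)^k}
  have hOo : ∀ k, IsOpen (O k) := fun k => by
    have h1 : Continuous fun x : Fin (n+1) → ℝ => x 0 := continuous_apply 0
    exact (isOpen_lt continuous_const h1).inter (isOpen_lt h1 continuous_const)
  have hOlt : ∀ k l, k < l → ∀ x, x ∈ O k → x ∈ O l → False := by
    intro k l hkl x hk hl
    have h3 : (1/2:ℝ)^l ≤ (1/2:ℝ)^(k+1) :=
      pow_le_pow_of_le_one (by norm_num) (by norm_num) hkl
    have h2 : (0:ℝ) < (1/2:ℝ)^k := by positivity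
    rw [pow_succ] at h3
    have h4 := hk.1
    have h5 := hl.2
    linarith
  have hOu : ∀ k l x, x ∈ O k → x ∈ O l → k = l := by
    intro k l x hk hl
    rcases lt_trichotomy k l with h | h | h
    · exact (hOlt k l h x hk hl).elim
    · exact h
    · exact (hOlt l k h x hl hk).elim
  have hHO : ∀ k, H k '' K k ⊆ O k := by
    intro k x hx
    have h1 := hb k x hx
    have h2 : (0:ℝ) < (1/2:ℝ)^k := by positivity
    have h5 : x 0 ≤ ‖x‖ := (le_abs_self _).trans (norm_le_pi_norm x 0)
    constructor <;> linarith [h1.1, h1.2]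
  let F : (Fin (n+1) → ℝ) → W := fun x => if hx : ∃ k, x ∈ O k then f hx.choose (Jv hx.choose x) else w
  have hFO : ∀ k x, x ∈ O k → F x = f k (Jv k x) := by
    intro k x hx
    have hex : ∃ k, x ∈ O k := ⟨k, hx⟩
    have : hex.choose = k := hOu _ _ x hex.choose_spec hx
    simp only [F, hex, dif_pos]
    rw [this]
  have hO0 : ∀ k, (0 : Fin (n+1) → ℝ) ∉ O k := fun k h0 => by
    have h2 : (0:ℝ) < (1/2:ℝ)^k := by positivity
    have h3 : (7/10) * (1/2:ℝ)^k < (0:ℝ) := h0.1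
    linarith
  have hF0 : F 0 = w := by
    have : ¬ ∃ k, (0 : Fin (n+1) → ℝ) ∈ O k := fun ⟨k, hk⟩ => hO0 k hk
    simp only [F, this, dif_neg, not_false_eq_true]
  have hFB : ∀ k, ∀ x ∈ H k '' B k, dist (F x) w < 1 / ((k:ℝ)+1) := by
    rintro k _ ⟨x, hx, rfl⟩
    rw [hFO k _ (hHO k ⟨x, hBK k hx, rfl⟩), hIH]
    exact hfB k hx
  have hFc : ContinuousOn F ({0} ∪ ⋃ k, H k '' B k) := by
    rintro x (hx | hx)
    · rw [mem_singleton_iff] at hx; subst hx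
      rw [Metric.continuousWithinAt_iff]
      intro η hη
      obtain ⟨N, hN⟩ := exists_nat_one_div_lt hη
      refine ⟨(3/4) * (1/2:ℝ)^N, by positivity, ?_⟩
      rintro y (hy | hy) hyd
      · rw [mem_singleton_iff] at hy; subst hy; simpa using hη
      · obtain ⟨k, hk⟩ := mem_iUnion.1 hy
        rw [hF0]
        refine (hFB k y hk).trans (lt_of_le_of_lt ?_ hN)
        have hNk : N ≤ k := by
          by_contra hkN
          have h3 : (1/2:ℝ)^N ≤ (1/2:ℝ)^k :=
            pow_le_pow_of_le_one (by norm_num) (by norm_num) (not_le.1 hkN).le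
          have h4 := (hbB k y hk).1
          have h5 : y 0 ≤ ‖y‖ := (le_abs_self _).trans (norm_le_pi_norm y 0)
          rw [dist_zero_right] at hyd
          linarith
        have : (N:ℝ) ≤ k := by exact_mod_cast hNk
        exact one_div_le_one_div_of_le (by positivity) (by linarith)
    · obtain ⟨k, hk⟩ := mem_iUnion.1 hx
      have hxO : x ∈ O k := hHO k (image_mono (hBK k) hk)
      have h1 : ContinuousOn (fun x => f k (Jv k x)) (H k '' B k) := by
        refine (hf k).comp (hIc k).continuousOn ?_
        rintro _ ⟨y, hy, rfl⟩
        rw [hIH]; exact hy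
      have h2 : ContinuousWithinAt F (H k '' B k) x :=
        (h1 x hk).congr (fun y hy => hFO k y (hHO k (image_mono (hBK k) hy))) (hFO k x hxO)
      refine h2.mono_of_mem_nhdsWithin ?_
      rw [mem_nhdsWithin]
      refine ⟨O k, hOo k, hxO, ?_⟩
      rintro y ⟨hyO, hy | hy⟩
      · rw [mem_singleton_iff] at hy; subst hy; exact (hO0 k hyO).elim
      · obtain ⟨l, hl⟩ := mem_iUnion.1 hy
        have : l = k := hOu l k y (hHO l (image_mono (hBK l) hl)) hyO
        subst this; exact hl
  obtain ⟨g, hgc, hgF, -⟩ := h _ _ hMK hBcl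
    (union_subset_union_right _ (iUnion_mono fun k => image_mono (hBK k))) F hFc (fun _ _ => trivial)
  have hg0 : g 0 = w := (hgF (Or.inl rfl)).trans hF0
  obtain ⟨ρ, hρ, hgρ⟩ := Metric.continuousWithinAt_iff.1 (hgc 0 (Or.inl rfl)) ε hε
  obtain ⟨N, hN⟩ := exists_pow_lt_of_lt_one (show 0 < ρ / 2 by positivity) (show (1/2:ℝ) < 1 by norm_num)
  refine hno N (fun x => g (H N x)) ?_ ?_ ?_
  · exact hgc.comp (hHc N).continuousOn fun x hx => Or.inr (mem_iUnion.2 ⟨N, x, hx, rfl⟩)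
  · intro x hx
    have : g (H N x) = F (H N x) := hgF (Or.inr (mem_iUnion.2 ⟨N, x, hx, rfl⟩))
    show g (H N x) = _
    rw [this, hFO N _ (hHO N ⟨x, hBK N hx, rfl⟩), hIH]
  · intro x hx
    have h1 := hgρ (x := H N x) (Or.inr (mem_iUnion.2 ⟨N, x, hx, rfl⟩)) (by
      rw [dist_zero_right]
      have := (hb N _ ⟨x, hx, rfl⟩).2
      linarith)
    rw [hg0] at h1
    exact h1

theorem ExtP.transport {n : ℕ} {W : Type*} [TopologicalSpace W] {S₁ S₂ : Set W}
    (h : ExtP n S₁ S₂) {E : Type*} [TopologicalSpace E] [T2Space E] {Q B : Set E} (hQ : IsCompact Q)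
    (hB : IsClosed B) (hBQ : B ⊆ Q) (e : E → (Fin n → ℝ)) (he : Continuous e) (hinj : InjOn e Q)
    (f : E → W) (hf : ContinuousOn f B) (hfS : MapsTo f B S₁) :
    ∃ g : E → W, ContinuousOn g Q ∧ EqOn g f B ∧ MapsTo g Q S₂ := by
  rcases Q.eq_empty_or_nonempty with rfl | ⟨q₀, hq₀⟩
  · exact ⟨f, continuousOn_empty _, fun x _ => rfl, fun x hx => hx.elim⟩
  have : Nonempty E := ⟨q₀⟩
  have hinv := hinj.leftInvOn_invFunOn
  have hBc := hQ.of_isClosed_subset hB hBQ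
  have hcont : ContinuousOn (Function.invFunOn e Q) (e '' Q) := by
    rw [continuousOn_iff_isClosed]
    intro t ht
    refine ⟨e '' (t ∩ Q), ((hQ.inter_left ht).image he).isClosed, ?_⟩
    ext y
    constructor
    · rintro ⟨hy, ⟨q, hq, rfl⟩⟩
      have hy' : Function.invFunOn e Q (e q) ∈ t := hy
      rw [hinv hq] at hy'
      exact ⟨⟨q, ⟨hy', hq⟩, rfl⟩, ⟨q, hq, rfl⟩⟩
    · rintro ⟨⟨q, ⟨hqt, hq⟩, rfl⟩, h2⟩
      refine ⟨?_, h2⟩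
      show Function.invFunOn e Q (e q) ∈ t
      rw [hinv hq]; exact hqt
  obtain ⟨g, hg1, hg2, hg3⟩ := h (e '' Q) (e '' B) (hQ.image he) (hBc.image he).isClosed
    (image_mono hBQ) (f ∘ Function.invFunOn e Q)
    (hf.comp (hcont.mono (image_mono hBQ)) (by
      rintro _ ⟨q, hq, rfl⟩; rw [hinv (hBQ hq)]; exact hq))
    (by rintro _ ⟨q, hq, rfl⟩; simp only [Function.comp_apply]; rw [hinv (hBQ hq)]; exact hfS hq)
  refine ⟨g ∘ e, hg1.comp he.continuousOn (mapsTo_image e Q), ?_, fun q hq => hg3 ⟨q, hq, rfl⟩⟩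
  intro q hq
  have := hg2 ⟨q, hq, rfl⟩
  simp only [Function.comp_apply] at this ⊢
  rw [this, hinv (hBQ hq)]
end LiftAux

namespace LiftAux

/-- The closed simplex with vertex set `s` inside `ι → ℝ`. -/
def Smp {ι : Type*} (s : Finset ι) : Set (ι → ℝ) :=
  {t | (∀ i, 0 ≤ t i) ∧ (∀ i, i ∉ s → t i = 0) ∧ ∑ i ∈ s, t i = 1}

/-- The boundary of the simplex. -/
def Bdr {ι : Type*} (s : Finset ι) : Set (ι → ℝ) := ⋃ i ∈ s, Smp (s.erase i)

theorem isClosed_smp {ι : Type*} (s : Finset ι) : IsClosed (Smp s) := by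
  have h : Smp s = (⋂ i, {t | 0 ≤ t i}) ∩ (⋂ i, ⋂ (_ : i ∉ s), {t | t i = 0}) ∩
      {t : ι → ℝ | ∑ i ∈ s, t i = 1} := by
    ext t; simp [Smp, and_assoc]
  rw [h]
  refine ((isClosed_iInter fun i => isClosed_le continuous_const (continuous_apply i)).inter
    (isClosed_iInter fun i => isClosed_iInter fun _ => isClosed_eq (continuous_apply i) continuous_const)).inter
    (isClosed_eq (by fun_prop) continuous_const)

theorem isCompact_smp {ι : Type*} (s : Finset ι) : IsCompact (Smp s) := by
  refine (isCompact_univ_pi (fun _ : ι => isCompact_Icc (a := (0:ℝ)) (b := 1))).of_isClosed_subset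
    (isClosed_smp s) ?_
  rintro t ⟨h0, h1, h2⟩ i -
  refine ⟨h0 i, ?_⟩
  by_cases hi : i ∈ s
  · rw [← h2]; exact Finset.single_le_sum (fun j _ => h0 j) hi
  · rw [h1 i hi]; exact zero_le_one

theorem smp_mono {ι : Type*} {s t : Finset ι} (h : s ⊆ t) : Smp s ⊆ Smp t := by
  rintro x ⟨h0, h1, h2⟩
  refine ⟨h0, fun i hi => h1 i fun his => hi (h his), ?_⟩
  rw [← h2]
  exact (Finset.sum_subset h fun i _ hi => h1 i hi).symm

theorem bdr_subset {ι : Type*} (s : Finset ι) : Bdr s ⊆ Smp s :=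
  iUnion₂_subset fun i _ => smp_mono (Finset.erase_subset i s)

theorem isClosed_bdr {ι : Type*} (s : Finset ι) : IsClosed (Bdr s) :=
  isClosed_biUnion_finset fun i _ => isClosed_smp _

/-- The support condition: `t` lies in the interior of the simplex `s`. -/
def Inr {ι : Type*} (s : Finset ι) : Set (ι → ℝ) := {t | t ∈ Smp s ∧ ∀ i ∈ s, t i ≠ 0}

theorem inr_unique {ι : Type*} {s s' : Finset ι} {t : ι → ℝ} (h : t ∈ Inr s) (h' : t ∈ Smp s') :
    s ⊆ s' := by
  intro i hi
  by_contra hc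
  exact h.2 i hi (h'.2.1 i hc)

theorem smp_cases {ι : Type*} {s : Finset ι} {t : ι → ℝ} (h : t ∈ Smp s) :
    t ∈ Bdr s ∨ t ∈ Inr s := by
  by_cases hc : ∀ i ∈ s, t i ≠ 0
  · exact Or.inr ⟨h, hc⟩
  · push Not at hc
    obtain ⟨i, hi, h0⟩ := hc
    refine Or.inl (mem_iUnion₂.2 ⟨i, hi, h.1, ?_, ?_⟩)
    · intro j hj
      by_cases hji : j = i
      · rw [hji]; exact h0
      · exact h.2.1 j fun hjs => hj (Finset.mem_erase.2 ⟨hji, hjs⟩)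
    · have := Finset.add_sum_erase s t hi
      rw [h0, zero_add, h.2.2] at this
      exact this

theorem bdr_nonempty {ι : Type*} {s : Finset ι} (h : 2 ≤ s.card) : (Bdr s).Nonempty := by
  obtain ⟨i, hi, j, hj, hij⟩ := Finset.one_lt_card.1 h
  refine ⟨Pi.single j 1, mem_iUnion₂.2 ⟨i, hi, ?_, ?_, ?_⟩⟩
  · intro k
    by_cases hk : k = j
    · subst hk; simp
    · simp [hk]
  · intro k hk
    have : k ≠ j := fun hkj => hk (Finset.mem_erase.2 ⟨hkj ▸ hij.symm, hkj ▸ hj⟩)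
    simp [this]
  · have hj' : j ∈ s.erase i := Finset.mem_erase.2 ⟨hij.symm, hj⟩
    rw [Finset.sum_eq_single_of_mem j hj' (fun k _ hk => by simp [hk])]
    simp

theorem smp_coords {ι : Type*} {n : ℕ} {s : Finset ι} (hne : s.Nonempty) (hs : s.card ≤ n + 1) :
    ∃ e : (ι → ℝ) → (Fin n → ℝ), Continuous e ∧ InjOn e (Smp s) := by
  obtain ⟨i₀, hi₀⟩ := hne
  have hcard : (s.erase i₀).card ≤ n := by rw [Finset.card_erase_of_mem hi₀]; omega
  let q : Fin n → ι := fun j =>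
    if h : j.1 < (s.erase i₀).card then ((s.erase i₀).equivFin.symm ⟨j, h⟩).1 else i₀
  have hq : ∀ i ∈ s.erase i₀, ∃ j, q j = i := by
    intro i hi
    refine ⟨⟨(s.erase i₀).equivFin ⟨i, hi⟩, lt_of_lt_of_le (Fin.is_lt _) hcard⟩, ?_⟩
    simp [q]
  refine ⟨fun t j => t (q j), by fun_prop, ?_⟩
  intro t ht t' ht' heq
  have h1 : ∀ i ∈ s.erase i₀, t i = t' i := fun i hi => by
    obtain ⟨j, rfl⟩ := hq i hi
    exact congrFun heq j
  have h2 : t i₀ = t' i₀ := by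
    have ha := Finset.add_sum_erase s t hi₀
    have hb := Finset.add_sum_erase s t' hi₀
    rw [ht.2.2] at ha
    rw [ht'.2.2, ← Finset.sum_congr rfl h1] at hb
    linarith
  funext i
  by_cases hi : i ∈ s
  · by_cases hii : i = i₀
    · rw [hii]; exact h2
    · exact h1 i (Finset.mem_erase.2 ⟨hii, hi⟩)
  · rw [ht.2.1 i hi, ht'.2.1 i hi]

theorem near_opt {E W : Type*} [MetricSpace W] (S : Set E) (hS : S.Nonempty) (P : (E → W) → Prop)
    (hP : ∃ g, P g) {η : ℝ} (hη : 0 < η) :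
    ∃ g, P g ∧ ∀ g', P g' → ∀ r, (∀ x ∈ S, ∀ y ∈ S, dist (g' x) (g' y) ≤ r) →
      ∀ x ∈ S, ∀ y ∈ S, dist (g x) (g y) ≤ r + η := by
  let T : Set ℝ := {r | ∃ g', P g' ∧ ∀ x ∈ S, ∀ y ∈ S, dist (g' x) (g' y) ≤ r}
  obtain ⟨x₀, hx₀⟩ := hS
  have hT0 : ∀ r ∈ T, 0 ≤ r := by
    rintro r ⟨g', -, hr⟩
    simpa using hr x₀ hx₀ x₀ hx₀
  have hbdd : BddBelow T := ⟨0, hT0⟩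
  rcases T.eq_empty_or_nonempty with hT | hT
  · obtain ⟨g, hg⟩ := hP
    refine ⟨g, hg, fun g' hg' r hr => ?_⟩
    have : r ∈ T := ⟨g', hg', hr⟩
    rw [hT] at this; exact this.elim
  · obtain ⟨r₀, ⟨g, hg, hgr⟩, hr₀⟩ := exists_lt_of_csInf_lt hT (lt_add_of_pos_right (sInf T) hη)
    refine ⟨g, hg, fun g' hg' r hr x hx y hy => (hgr x hx y hy).trans ?_⟩
    have := csInf_le hbdd (show r ∈ T from ⟨g', hg', hr⟩)
    linarith

/-- Skeletal construction. -/
theorem skeletal {n : ℕ} {W : Type*} [MetricSpace W] (hW : ExtP n (univ : Set W) univ)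
    {Y : Type*} [MetricSpace Y] (A : Set Y) (f : A → W) {ι : Type*} (c : ι → Y) (v : ι → W)
    (hv : ∀ a : A, ∀ ε > 0, ∃ δ > 0, ∀ i, dist (c i) a < δ → dist (v i) (f a) < ε)
    (r : ι → ℝ) (hr : ∀ i, 0 < r i) (hrd : ∀ i, ∀ a : A, r i ≤ dist (c i) a) (w₀ : W)
    (m : ℕ) (hm : m ≤ n) :
    ∃ G : (ι → ℝ) → W, (∀ s : Finset ι, s.card ≤ m + 1 → ContinuousOn G (Smp s)) ∧
      ∀ a : A, ∀ ε > 0, ∃ δ > 0, ∀ s : Finset ι, s.card ≤ m + 1 → (∀ i ∈ s, dist (c i) a < δ) →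
        ∀ t ∈ Smp s, dist (G t) (f a) < ε := by
  induction m with
  | zero =>
    let G : (ι → ℝ) → W := fun t => if h : ∃ i, t i ≠ 0 then v h.choose else w₀
    have hG : ∀ s : Finset ι, s.card ≤ 0 + 1 → ∀ t ∈ Smp s, ∃ i, s = {i} ∧ G t = v i := by
      intro s hs t ht
      have hne : ∃ i, t i ≠ 0 := by
        by_contra h0
        push Not at h0
        have := ht.2.2
        rw [Finset.sum_eq_zero fun i _ => h0 i] at this
        exact zero_ne_one this
      have hmem : hne.choose ∈ s := by
        by_contra h0
        exact hne.choose_spec (ht.2.1 _ h0)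
      refine ⟨hne.choose, ?_, ?_⟩
      · have h1 := Finset.card_le_one.1 (by simpa using hs)
        ext j
        rw [Finset.mem_singleton]
        exact ⟨fun hj => h1 j hj _ hmem, fun hj => hj ▸ hmem⟩
      · simp only [G, hne, dif_pos]
    refine ⟨G, ?_, ?_⟩
    · intro s hs
      rcases s.eq_empty_or_nonempty with rfl | ⟨i, hi⟩
      · intro t ht
        have := ht.2.2
        simp at this
      · refine (continuousOn_const (c := v i)).congr fun t ht => ?_
        obtain ⟨j, rfl, hj⟩ := hG s hs t ht
        rw [Finset.mem_singleton] at hi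
        rw [hj, hi]
    · intro a ε hε
      obtain ⟨δ, hδ, h⟩ := hv a ε hε
      refine ⟨δ, hδ, fun s hs hsd t ht => ?_⟩
      obtain ⟨j, rfl, hj⟩ := hG s hs t ht
      rw [hj]
      exact h j (hsd j (Finset.mem_singleton_self j))
  | succ m ih =>
    obtain ⟨G, hGc, hGn⟩ := ih (by omega)
    obtain ⟨n, rfl⟩ : ∃ n', n = n' + 1 := ⟨n - 1, by omega⟩
    have hbd : ∀ s : Finset ι, s.card = m + 2 → ContinuousOn G (Bdr s) := by
      intro s hs
      have := (locallyFinite_of_finite (fun i : s => Smp (s.erase i.1))).continuousOn_iUnion (g := G)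
        (fun i => isClosed_smp _) (fun i => hGc _ (by rw [Finset.card_erase_of_mem i.2]; omega))
      convert this using 1
      simp only [Bdr]
      ext x
      simp only [mem_iUnion]
      exact ⟨fun ⟨i, hi, h⟩ => ⟨⟨i, hi⟩, h⟩, fun ⟨i, h⟩ => ⟨i.1, i.2, h⟩⟩
    have hE : ∀ s : Finset ι, ∃ E : (ι → ℝ) → W, s.card = m + 2 →
        (ContinuousOn E (Smp s) ∧ EqOn E G (Bdr s)) ∧
        ∀ E' : (ι → ℝ) → W, (ContinuousOn E' (Smp s) ∧ EqOn E' G (Bdr s)) → ∀ ρ,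
          (∀ x ∈ Smp s, ∀ y ∈ Smp s, dist (E' x) (E' y) ≤ ρ) →
          ∀ i ∈ s, ∀ x ∈ Smp s, ∀ y ∈ Smp s, dist (E x) (E y) ≤ ρ + r i := by
      intro s
      by_cases hs : s.card = m + 2
      swap
      · exact ⟨G, fun h => absurd h hs⟩
      have hne : s.Nonempty := Finset.card_pos.1 (by omega)
      obtain ⟨e, hec, hei⟩ := smp_coords (n := n+1) hne (by omega)
      obtain ⟨E₀, h1, h2, -⟩ := hW.transport (isCompact_smp s) (isClosed_bdr s) (bdr_subset s) e hec hei G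
        (hbd s hs) (fun _ _ => trivial)
      obtain ⟨i₀, hi₀, hmin⟩ := s.exists_min_image r hne
      obtain ⟨E, hE1, hE2⟩ := near_opt (Smp s) ((bdr_nonempty (by omega)).mono (bdr_subset s))
        (fun E : (ι → ℝ) → W => ContinuousOn E (Smp s) ∧ EqOn E G (Bdr s)) ⟨E₀, h1, h2⟩ (hr i₀)
      refine ⟨E, fun _ => ⟨hE1, fun E' hE' ρ hρ i hi x hx y hy => ?_⟩⟩
      exact (hE2 E' hE' ρ hρ x hx y hy).trans (by linarith [hmin i hi])
    choose E hE using hE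
    let G' : (ι → ℝ) → W := fun t => if h : ∃ s : Finset ι, s.card = m + 2 ∧ t ∈ Inr s
      then E h.choose t else G t
    have hG'1 : ∀ s : Finset ι, s.card = m + 2 → EqOn G' (E s) (Smp s) := by
      intro s hs t ht
      by_cases h : ∃ s : Finset ι, s.card = m + 2 ∧ t ∈ Inr s
      · have h1 : h.choose ⊆ s := inr_unique h.choose_spec.2 ht
        have h2 : h.choose = s := Finset.eq_of_subset_of_card_le h1 (by rw [h.choose_spec.1, hs])
        simp only [G', h, dif_pos]
        rw [h2]
      · simp only [G', h, dif_neg, not_false_eq_true]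
        rcases smp_cases ht with hb | hb
        · exact ((hE s hs).1.2 hb).symm
        · exact absurd ⟨s, hs, hb⟩ h
    have hG'2 : ∀ s : Finset ι, s.card ≤ m + 1 → EqOn G' G (Smp s) := by
      intro s hs t ht
      have h : ¬ ∃ s : Finset ι, s.card = m + 2 ∧ t ∈ Inr s := by
        rintro ⟨s', hs', ht'⟩
        have := Finset.card_le_card (inr_unique ht' ht)
        omega
      simp only [G', h, dif_neg, not_false_eq_true]
    refine ⟨G', ?_, ?_⟩
    · intro s hs
      rcases Nat.lt_or_ge s.card (m+2) with h | h
      · exact (hGc s (by omega)).congr (hG'2 s (by omega))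
      · have hs' : s.card = m + 2 := by omega
        exact (hE s hs').1.1.congr (hG'1 s hs')
    · intro a ε hε
      obtain ⟨δ₁, hδ₁, hloc⟩ := local_ext hW (f a) (show 0 < ε / 8 by positivity)
      obtain ⟨δ₂, hδ₂, hn⟩ := hGn a (min δ₁ (ε/8)) (by positivity)
      refine ⟨min δ₂ (ε/8), by positivity, fun s hs hsd t ht => ?_⟩
      rcases Nat.lt_or_ge s.card (m+2) with h | h
      · rw [hG'2 s (by omega) ht]
        have := hn s (by omega) (fun i hi => (hsd i hi).trans_le (min_le_left _ _)) t ht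
        have h8 : min δ₁ (ε/8) ≤ ε/8 := min_le_right _ _
        linarith
      · have hs' : s.card = m + 2 := by omega
        rw [hG'1 s hs' ht]
        have hB : ∀ x ∈ Bdr s, dist (G x) (f a) < min δ₁ (ε/8) := by
          intro x hx
          obtain ⟨i, hi, hx⟩ := mem_iUnion₂.1 hx
          refine hn (s.erase i) (by rw [Finset.card_erase_of_mem hi]; omega)
            (fun j hj => (hsd j (Finset.mem_of_mem_erase hj)).trans_le (min_le_left _ _)) x hx
        have hne : s.Nonempty := Finset.card_pos.1 (by omega)
        obtain ⟨e, hec, hei⟩ := smp_coords (n := n+1) hne (by omega)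
        obtain ⟨E', h1, h2, h3⟩ := hloc.transport (isCompact_smp s) (isClosed_bdr s) (bdr_subset s)
          e hec hei G (hbd s hs') (fun x hx => mem_ball.2 ((hB x hx).trans_le (min_le_left _ _)))
        obtain ⟨i, hi⟩ := hne
        obtain ⟨b, hb⟩ := bdr_nonempty (show 2 ≤ s.card by omega)
        have h4 := (hE s hs').2 E' ⟨h1, h2⟩ (ε/4) (fun x hx y hy => by
          have hx' := mem_ball.1 (h3 hx)
          have hy' := mem_ball.1 (h3 hy)
          have := dist_triangle_right (E' x) (E' y) (f a)
          linarith) i hi t ht b (bdr_subset s hb)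
        have h5 : r i < ε / 8 := (hrd i a).trans_lt ((hsd i hi).trans_le (min_le_right _ _))
        have h6 := (hB b hb).trans_le (min_le_right _ _)
        rw [← (hE s hs').1.2 hb] at h6
        have := dist_triangle (E s t) (E s b) (f a)
        linarith

theorem isAE_universe.{a, b} {n : ℕ} {W : Type*} [MetricSpace W] (h : IsAE.{a} n W) :
    IsAE.{b} n W := by
  have hW := extP_of_isAE h
  intro Y _ hdim A hA f
  obtain ⟨w₀⟩ : Nonempty W := by
    have hd : CovDimLE (PUnit.{a+1}) n := by
      intro U hU hc
      refine ⟨{univ}, by simp, by simp, ?_, ?_⟩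
      · have : PUnit.unit ∈ ⋃₀ U := by rw [hc]; trivial
        obtain ⟨u, hu, hx⟩ := this
        rintro r rfl
        exact ⟨u, hu, fun y _ => hx⟩
      · intro x
        have hsub : {r ∈ ({univ} : Set (Set PUnit.{a+1})) | x ∈ r} ⊆ {univ} := fun r hr => hr.1
        exact ⟨(finite_singleton _).subset hsub,
          (ncard_le_ncard hsub (finite_singleton _)).trans (by simp)⟩
    letI : MetricSpace PUnit.{a+1} := inferInstance
    obtain ⟨g, -⟩ := h PUnit.{a+1} hd ∅ isClosed_empty
      ⟨fun x => (x.2 : False).elim, continuous_of_const fun x => (x.2 : False).elim⟩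
    exact ⟨g PUnit.unit⟩
  rcases A.eq_empty_or_nonempty with rfl | hne
  · exact ⟨ContinuousMap.const _ w₀, fun a => (a.2 : False).elim⟩
  let ι := {y : Y // y ∉ A}
  let d : Y → ℝ := fun y => infDist y A
  have hd0 : ∀ i : ι, 0 < d i.1 := fun i => (hA.notMem_iff_infDist_pos hne).1 i.2
  obtain ⟨V, hVo, hVU, hVc, hVn⟩ := refine_open hdim A hA hne (fun i : ι => ball i.1 (d i.1 / 4))
    (fun i => isOpen_ball) (by
      refine subset_antisymm (iUnion_subset fun i y hy hyA => ?_) fun y hy =>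
        mem_iUnion.2 ⟨⟨y, hy⟩, mem_ball_self (by have := hd0 ⟨y, hy⟩; positivity)⟩
      have h1 : d i.1 ≤ dist i.1 y := infDist_le_dist_of_mem hyA
      have h2 := mem_ball'.1 hy
      linarith [hd0 i])
  have hnear : ∀ i : ι, ∃ a : A, dist i.1 a.1 < 2 * d i.1 := fun i => by
    obtain ⟨a, ha, hlt⟩ := (infDist_lt_iff (x := i.1) hne).1 (show infDist i.1 A < 2 * d i.1 by
      have : 0 < infDist i.1 A := hd0 i
      show infDist i.1 A < 2 * infDist i.1 A
      linarith)
    exact ⟨⟨a, ha⟩, hlt⟩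
  choose α hα using hnear
  obtain ⟨G, hGc, hGn⟩ := skeletal hW A f (fun i : ι => i.1) (fun i => f (α i))
    (by
      intro a ε hε
      obtain ⟨δ, hδ, hf⟩ := Metric.continuousAt_iff.1 (f.continuous.continuousAt (x := a)) ε hε
      refine ⟨δ / 3, by positivity, fun i hi => hf ?_⟩
      have h1 : d i.1 ≤ dist i.1 a.1 := infDist_le_dist_of_mem a.2
      have h2 := hα i
      have h3 := dist_triangle_left (α i).1 a.1 i.1
      show dist (α i).1 a.1 < δ
      linarith)
    (fun i => d i.1) hd0 (fun i a => infDist_le_dist_of_mem a.2) w₀ n le_rfl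
  obtain ⟨φ, hφ⟩ := PartitionOfUnity.exists_isSubordinate (X := ι) isClosed_univ
    (fun i : ι => (Subtype.val ⁻¹' V i : Set ι)) (fun i => (hVo i).preimage continuous_subtype_val)
    (by
      intro y _
      have : y.1 ∈ ⋃ i, V i := by rw [hVc]; exact y.2
      obtain ⟨i, hi⟩ := mem_iUnion.1 this
      exact mem_iUnion.2 ⟨i, hi⟩)
  let Φ : ι → (ι → ℝ) := fun y i => φ i y
  have hΦc : Continuous Φ := continuous_pi fun i => (φ i).continuous
  have hVmem : ∀ y i, Φ y i ≠ 0 → y.1 ∈ V i := fun y i hi =>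
    hφ i (subset_tsupport _ hi)
  have hsupp : ∀ y, ∃ s : Finset ι, s.card ≤ n + 1 ∧ (∀ i, i ∈ s ↔ Φ y i ≠ 0) := by
    intro y
    have hsub : {i | Φ y i ≠ 0} ⊆ {i | y.1 ∈ V i} := fun i hi => hVmem y i hi
    have hfin := (hVn y.1 y.2).1.subset hsub
    refine ⟨hfin.toFinset, ?_, fun i => by simp⟩
    rw [← ncard_eq_toFinset_card _ hfin]
    exact (ncard_le_ncard hsub (hVn y.1 y.2).1).trans (hVn y.1 y.2).2
  have hmemS : ∀ y (s : Finset ι), (∀ i, i ∉ s → Φ y i = 0) → Φ y ∈ Smp s := by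
    intro y s hs
    refine ⟨fun i => φ.nonneg i y, hs, ?_⟩
    rw [← φ.sum_eq_one (mem_univ y)]
    refine (finsum_eq_sum_of_support_subset _ ?_).symm
    intro i hi
    by_contra h0
    exact hi (hs i h0)
  have hcO : Continuous fun y => G (Φ y) := by
    rw [continuous_iff_continuousAt]
    intro y
    obtain ⟨N, hN, hfin⟩ := φ.locallyFinite y
    let T := hfin.toFinset
    let Ix := {s : Finset ι // s ∈ T.powerset.filter fun s => s.card ≤ n + 1}
    have : Finite Ix := by
      show Finite {s : Finset ι // s ∈ T.powerset.filter fun s => s.card ≤ n + 1}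
      infer_instance
    have h1 : ContinuousOn (fun y => G (Φ y)) (⋃ s : Ix, {y | ∀ i, i ∉ s.1 → Φ y i = 0}) := by
      refine (locallyFinite_of_finite _).continuousOn_iUnion ?_ ?_
      · intro s
        have : {y | ∀ i, i ∉ s.1 → Φ y i = 0} = ⋂ i, ⋂ (_ : i ∉ s.1), {y | Φ y i = 0} := by
          ext y; simp
        rw [this]
        exact isClosed_iInter fun i => isClosed_iInter fun _ =>
          isClosed_eq ((continuous_apply i).comp hΦc) continuous_const
      · intro s
        exact (hGc s.1 (Finset.mem_filter.1 s.2).2).comp hΦc.continuousOn fun y hy => hmemS y s.1 hy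
    refine h1.continuousAt (Filter.mem_of_superset hN fun z hz => ?_)
    obtain ⟨s, hs, hsi⟩ := hsupp z
    refine mem_iUnion.2 ⟨⟨s, Finset.mem_filter.2 ⟨Finset.mem_powerset.2 fun i hi => ?_, hs⟩⟩, ?_⟩
    · rw [Set.Finite.mem_toFinset]
      exact ⟨z, (hsi i).1 hi, hz⟩
    · intro i hi
      by_contra h0
      exact hi ((hsi i).2 h0)
  let g : Y → W := fun y => if hy : y ∈ A then f ⟨y, hy⟩ else G (Φ ⟨y, hy⟩)
  have hgA : ∀ a : A, g a.1 = f a := fun a => by simp [g]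
  have hgO : ∀ y : ι, g y.1 = G (Φ y) := fun y => by simp [g, y.2]
  refine ⟨⟨g, ?_⟩, hgA⟩
  rw [continuous_iff_continuousAt]
  intro y
  by_cases hy : y ∈ A
  · rw [Metric.continuousAt_iff]
    intro ε hε
    obtain ⟨δ₁, hδ₁, h1⟩ := Metric.continuousAt_iff.1 (f.continuous.continuousAt (x := ⟨y, hy⟩)) ε hε
    obtain ⟨δ₂, hδ₂, h2⟩ := hGn ⟨y, hy⟩ ε hε
    refine ⟨min δ₁ (δ₂ / 2), by positivity, fun z hz => ?_⟩
    rw [hgA ⟨y, hy⟩]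
    by_cases hzA : z ∈ A
    · rw [hgA ⟨z, hzA⟩]
      exact h1 (hz.trans_le (min_le_left _ _))
    · rw [hgO ⟨z, hzA⟩]
      obtain ⟨s, hs, hsi⟩ := hsupp ⟨z, hzA⟩
      refine h2 s hs (fun i hi => ?_) _ (hmemS _ s fun i hi => by
        by_contra h0; exact hi ((hsi i).2 h0))
      have h3 : z ∈ ball i.1 (d i.1 / 4) := hVU i (hVmem _ _ ((hsi i).1 hi))
      rw [mem_ball'] at h3
      have h4 : d i.1 ≤ dist i.1 y := infDist_le_dist_of_mem hy
      have h5 := dist_triangle i.1 z y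
      have h6 := hz.trans_le (min_le_right _ _)
      show dist i.1 y < δ₂
      linarith [hd0 i]
  · have : ContinuousAt (fun z : ι => g z.1) ⟨y, hy⟩ := by
      have h1 : (fun z : ι => g z.1) = fun z => G (Φ z) := funext hgO
      rw [h1]
      exact hcO.continuousAt
    exact (hA.isOpen_compl.isOpenEmbedding_subtypeVal.continuousAt_iff (x := ⟨y, hy⟩)).1 this
end LiftAux

namespace LiftAux

def CS {X J : Type*} (C : J → Set X) (s : Finset J) : Set X := ⋂ i ∈ s, C i

def PK {X J : Type*} (C : J → Set X) (k : ℕ) (s : Finset J) : Prop :=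
  s.Nonempty ∧ ∀ t, s ⊆ t → (CS C t).Nonempty → t.card < s.card + k

def XX {X J : Type*} (C : J → Set X) (A : Set X) (k : ℕ) : Set X :=
  A ∪ ⋃ s : {s : Finset J // PK C k s}, CS C s.1

theorem mem_CS {X J : Type*} {C : J → Set X} {s : Finset J} {x : X} :
    x ∈ CS C s ↔ ∀ i ∈ s, x ∈ C i := by simp [CS]

theorem PK.up {X J : Type*} {C : J → Set X} {k : ℕ} {s u : Finset J} (h : PK C (k + 1) s)
    (hsu : s ⊂ u) : PK C k u := by
  refine ⟨h.1.mono hsu.1, fun t ht hne => ?_⟩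
  have := h.2 t (hsu.1.trans ht) hne
  have := Finset.card_lt_card hsu
  omega

theorem PK.mono {X J : Type*} {C : J → Set X} {k m : ℕ} (hkm : k ≤ m) {s : Finset J}
    (h : PK C k s) : PK C m s :=
  ⟨h.1, fun t ht hne => by have := h.2 t ht hne; omega⟩

theorem XX_mono {X J : Type*} {C : J → Set X} {A : Set X} {k m : ℕ} (hkm : k ≤ m) :
    XX C A k ⊆ XX C A m := by
  rintro x (h | h)
  · exact Or.inl h
  · obtain ⟨s, hs⟩ := mem_iUnion.1 h
    exact Or.inr (mem_iUnion.2 ⟨⟨s.1, s.2.mono hkm⟩, hs⟩)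

theorem mem_XX {X J : Type*} {C : J → Set X} {A : Set X} {k : ℕ} {s : Finset J} {x : X}
    (hs : PK C k s) (hx : x ∈ CS C s) : x ∈ XX C A k :=
  Or.inr (mem_iUnion.2 ⟨⟨s, hs⟩, hx⟩)

theorem isClosed_CS {X J : Type*} [TopologicalSpace X] {C : J → Set X} (hC : ∀ j, IsClosed (C j))
    (s : Finset J) : IsClosed (CS C s) :=
  isClosed_biInter fun i _ => hC i

theorem locallyFinite_CS {X J : Type*} [TopologicalSpace X] {C : J → Set X}
    (hlf : LocallyFinite C) (k : ℕ) :
    LocallyFinite fun s : {s : Finset J // PK C k s} => CS C s.1 := by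
  intro x
  obtain ⟨N, hN, hfin⟩ := hlf x
  refine ⟨N, hN, ?_⟩
  refine Set.Finite.subset
    ((hfin.toFinset.powerset.finite_toSet).preimage
      (f := fun s : {s : Finset J // PK C k s} => s.1) Subtype.val_injective.injOn) ?_
  rintro s ⟨y, hy, hyN⟩
  simp only [mem_preimage, Finset.mem_coe, Finset.mem_powerset]
  intro i hi
  rw [Set.Finite.mem_toFinset]
  exact ⟨y, mem_CS.1 hy i hi, hyN⟩

theorem isClosed_XX {X J : Type*} [TopologicalSpace X] {C : J → Set X} (hC : ∀ j, IsClosed (C j))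
    (hlf : LocallyFinite C) {A : Set X} (hA : IsClosed A) (k : ℕ) : IsClosed (XX C A k) :=
  hA.union ((locallyFinite_CS hlf k).isClosed_iUnion fun s => isClosed_CS hC s.1)

theorem strat.{v} {n : ℕ} {X : Type v} [MetricSpace X] (hdim : CovDimLE X n) {W : Type*}
    [TopologicalSpace W] {J : Type*} (C : J → Set X) (hC : ∀ j, IsClosed (C j))
    (hlf : LocallyFinite C) (hcov : ∀ x, ∃ j, x ∈ C j) (hfd : LocallyFinDimCover C)
    (D : J → Set W)
    (hD : ∀ s : Finset J, s.Nonempty → (CS C s).Nonempty → IsAE.{v} n (CS D s))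
    (A : Set X) (hA : IsClosed A) (g₀ : X → W) (hg₀ : ContinuousOn g₀ A)
    (hgD : ∀ j, ∀ x ∈ A, x ∈ C j → g₀ x ∈ D j) :
    ∃ g : X → W, Continuous g ∧ EqOn g g₀ A ∧ ∀ j, MapsTo g (C j) (D j) := by
  let Good : ℕ → (X → W) → Prop := fun k g =>
    ContinuousOn g (XX C A k) ∧ ∀ j, ∀ x ∈ XX C A k, x ∈ C j → g x ∈ D j
  have h0 : Good 0 g₀ := by
    have hX : XX C A 0 = A := by
      refine Subset.antisymm ?_ subset_union_left
      rintro x (h | h)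
      · exact h
      · obtain ⟨s, hs⟩ := mem_iUnion.1 h
        have := s.2.2 s.1 Subset.rfl ⟨x, hs⟩
        omega
    simp only [Good, hX]
    exact ⟨hg₀, hgD⟩
  have hstep : ∀ k g, Good k g → ∃ g', Good (k + 1) g' ∧ EqOn g' g (XX C A k) := by
    intro k g ⟨hgc, hgm⟩
    have hE : ∀ s : Finset J, ∃ E : X → W, PK C (k + 1) s →
        ContinuousOn E (CS C s) ∧ EqOn E g (XX C A k ∩ CS C s) ∧ MapsTo E (CS C s) (CS D s) := by
      intro s
      by_cases hs : PK C (k + 1) s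
      swap
      · exact ⟨g, fun h => absurd h hs⟩
      rcases (CS C s).eq_empty_or_nonempty with he | hne
      · refine ⟨g, fun _ => ?_⟩
        rw [he]
        exact ⟨continuousOn_empty _, by simp, mapsTo_empty _ _⟩
      have hae := hD s hs.1 hne
      obtain ⟨G, hG⟩ := hae (CS C s) (covDimLE_closed hdim (isClosed_CS hC s))
        (Subtype.val ⁻¹' XX C A k) ((isClosed_XX hC hlf hA k).preimage continuous_subtype_val)
        ⟨fun y => ⟨g y.1.1, mem_CS.2 fun i hi => hgm i _ y.2 (mem_CS.1 y.1.2 i hi)⟩, by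
          refine Continuous.subtype_mk ?_ _
          exact hgc.comp_continuous (continuous_subtype_val.comp continuous_subtype_val)
            fun y => y.2⟩
      refine ⟨fun x => if hx : x ∈ CS C s then (G ⟨x, hx⟩).1 else g x, fun _ => ⟨?_, ?_, ?_⟩⟩
      · rw [continuousOn_iff_continuous_domRestrict]
        have : (CS C s).domRestrict (fun x => if hx : x ∈ CS C s then (G ⟨x, hx⟩).1 else g x) =
            fun y => (G y).1 := by
          funext y
          simp [domRestrict_apply, y.2]
        rw [this]
        exact continuous_subtype_val.comp G.continuous
      · rintro x ⟨hx, hxs⟩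
        have := hG ⟨⟨x, hxs⟩, hx⟩
        simp only [hxs, dite_true]
        exact congrArg Subtype.val this
      · intro x hxs
        simp only [hxs, dite_true]
        exact (G ⟨x, hxs⟩).2
    choose E hE using hE
    let g' : X → W := fun x => if x ∈ XX C A k then g x else
      if h : ∃ s, PK C (k + 1) s ∧ x ∈ CS C s then E h.choose x else g x
    have hg'1 : EqOn g' g (XX C A k) := fun x hx => by simp [g', hx]
    have hg'2 : ∀ s, PK C (k + 1) s → EqOn g' (E s) (CS C s) := by
      intro s hs x hx
      by_cases hxk : x ∈ XX C A k
      · rw [hg'1 hxk, (hE s hs).2.1 ⟨hxk, hx⟩]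
      have h : ∃ s, PK C (k + 1) s ∧ x ∈ CS C s := ⟨s, hs, hx⟩
      have hst : h.choose = s := by
        by_contra hne
        obtain ⟨ht, hxt⟩ := h.choose_spec
        set t := h.choose
        have hu : x ∈ CS C (s ∪ t) := mem_CS.2 fun i hi => by
          rcases Finset.mem_union.1 hi with hi | hi
          · exact mem_CS.1 hx i hi
          · exact mem_CS.1 hxt i hi
        by_cases h1 : s ∪ t = s
        · have : t ⊂ s := lt_of_le_of_ne (Finset.union_eq_left.1 h1) hne
          exact hxk (mem_XX (ht.up this) hx)
        · have : s ⊂ s ∪ t := lt_of_le_of_ne Finset.subset_union_left (Ne.symm h1)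
          exact hxk (mem_XX (hs.up this) hu)
      simp only [g', hxk, if_false, h, dite_true, hst]
    refine ⟨g', ⟨?_, ?_⟩, hg'1⟩
    · refine ContinuousOn.union_of_isClosed ?_ ?_ hA
        ((locallyFinite_CS hlf (k + 1)).isClosed_iUnion fun s => isClosed_CS hC s.1)
      · exact (hgc.mono subset_union_left).congr fun x hx => hg'1 (Or.inl hx)
      · refine (locallyFinite_CS hlf (k + 1)).continuousOn_iUnion
          (fun s => isClosed_CS hC s.1) fun s => ?_
        exact (hE s.1 s.2).1.congr (hg'2 s.1 s.2)
    · intro j x hx hxj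
      by_cases hxk : x ∈ XX C A k
      · rw [hg'1 hxk]
        exact hgm j x hxk hxj
      rcases hx with hx | hx
      · exact absurd (Or.inl hx) hxk
      obtain ⟨⟨s, hs⟩, hxs⟩ := mem_iUnion.1 hx
      have hjs : j ∈ s := by
        by_contra hj
        refine hxk (mem_XX (hs.up (Finset.ssubset_insert hj)) (mem_CS.2 fun i hi => ?_))
        rcases Finset.mem_insert.1 hi with rfl | hi
        · exact hxj
        · exact mem_CS.1 hxs i hi
      rw [hg'2 s hs hxs]
      exact mem_CS.1 ((hE s hs).2.2 hxs) j hjs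
  choose! next hn1 hn2 using hstep
  let G : ℕ → X → W := fun k => Nat.rec g₀ (fun k g => next k g) k
  have hGood : ∀ k, Good k (G k) := by
    intro k
    induction k with
    | zero => exact h0
    | succ k ih => exact hn1 k _ ih
  have hEq : ∀ k m, k ≤ m → EqOn (G m) (G k) (XX C A k) := by
    intro k m hkm
    induction m, hkm using Nat.le_induction with
    | base => exact fun _ _ => rfl
    | succ m hm ih =>
      intro x hx
      rw [← ih hx]
      exact hn2 m _ (hGood m) (XX_mono hm hx)
  have hnb : ∀ x, ∃ k, XX C A k ∈ nhds x := by
    intro x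
    obtain ⟨N, hN, hfin⟩ := hlf x
    choose M hM using hfd
    refine ⟨∑ j ∈ hfin.toFinset, M j, Filter.mem_of_superset hN fun y hy => ?_⟩
    obtain ⟨j, hj⟩ := hcov y
    refine mem_XX (s := {j}) ⟨Finset.singleton_nonempty j, fun t ht hne => ?_⟩
      (mem_CS.2 fun i hi => by rw [Finset.mem_singleton.1 hi]; exact hj)
    have h1 := hM j t (ht (Finset.mem_singleton_self j)) hne
    have h2 : M j ≤ ∑ j ∈ hfin.toFinset, M j :=
      Finset.single_le_sum (f := M) (fun _ _ => Nat.zero_le _)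
        ((Set.Finite.mem_toFinset hfin).2 ⟨y, hj, hy⟩)
    rw [Finset.card_singleton]
    omega
  choose K hK using hnb
  let g : X → W := fun x => G (K x) x
  have hg : ∀ k, EqOn g (G k) (XX C A k) := by
    intro k x hx
    have h1 := hEq (K x) (max (K x) k) (le_max_left _ _) (mem_of_mem_nhds (hK x))
    have h2 := hEq k (max (K x) k) (le_max_right _ _) hx
    exact h1.symm.trans h2
  refine ⟨g, ?_, ?_, ?_⟩
  · rw [continuous_iff_continuousAt]
    intro x
    have := (hGood (K x)).1.continuousAt (hK x)
    exact this.congr (Filter.mem_of_superset (hK x) fun y hy => ((hg (K x)) hy).symm)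
  · intro x hx
    exact hg 0 (Or.inl hx)
  · intro j x hx
    exact (hGood (K x)).2 j x (mem_of_mem_nhds (hK x)) hx

end LiftAux

namespace LiftAux

theorem one_step {n : ℕ} {Z Z' J X : Type*} [MetricSpace Z] [MetricSpace Z'] [MetricSpace X]
    (p : Z' → Z) (hsurj : Function.Surjective p) (F : J → Set Z) (hcov : IsCover F)
    (halt : (∀ j, IsOpen (F j)) ∨
      ((∀ j, IsClosed (F j)) ∧ LocallyFinite F ∧ LocallyFinDimCover F))
    (hAE : IsAECover.{u} n (fun j => p ⁻¹' F j)) (hdim : CovDimLE X n)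
    (A : Set X) (hA : IsClosed A) (g : C(X, Z)) (g₀ : C(A, Z'))
    (hg : ∀ a : A, p (g₀ a) = g a.1) :
    ∃ g' : C(X, Z'), (∀ a : A, g' a.1 = g₀ a) ∧ ∀ x, edist (g x) (p (g' x)) ≤ coverMesh F := by
  have hclose : ∃ C : J → Set X, (∀ j, IsClosed (C j)) ∧ LocallyFinite C ∧
      (∀ x, ∃ j, x ∈ C j) ∧ LocallyFinDimCover C ∧ ∀ j, C j ⊆ g ⁻¹' F j := by
    rcases halt with ho | ⟨hc, hl, hf⟩
    · obtain ⟨V, hVo, hVs, hVc, hVn⟩ := indexed_refine hdim (fun j => g ⁻¹' F j)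
        (fun j => (ho j).preimage g.continuous) (by rw [← preimage_iUnion, hcov, preimage_univ])
      obtain ⟨V', hVo', hVc', hVl', hVs'⟩ := precise_refinement V hVo hVc
      obtain ⟨C, hCc, hCcl, hCs⟩ := exists_iUnion_eq_closed_subset hVo'
        (fun x => hVl'.point_finite x) hVc'
      refine ⟨C, hCcl, hVl'.subset hCs, fun x => mem_iUnion.1 (hCc ▸ mem_univ x), ?_,
        fun j => (hCs j).trans ((hVs' j).trans (hVs j))⟩
      intro j
      refine ⟨n + 1, fun s _ ⟨x, hx⟩ => ?_⟩
      have hsub : (s : Set J) ⊆ {i | x ∈ V i} := fun i hi =>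
        hVs' i (hCs i (mem_iInter₂.1 hx i hi))
      rw [← ncard_coe_finset s]
      exact (ncard_le_ncard hsub (hVn x).1).trans (hVn x).2
    · refine ⟨fun j => g ⁻¹' F j, fun j => (hc j).preimage g.continuous,
        hl.preimage_continuous g.continuous, fun x => ?_, ?_, fun j => Subset.rfl⟩
      · have hx : g x ∈ ⋃ j, F j := hcov ▸ mem_univ (g x)
        obtain ⟨j, hj⟩ := mem_iUnion.1 hx
        exact ⟨j, hj⟩
      · intro j
        obtain ⟨N, hN⟩ := hf j
        refine ⟨N, fun s hs ⟨x, hx⟩ => hN s hs ⟨g x, ?_⟩⟩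
        simp only [mem_iInter, mem_preimage] at hx ⊢
        exact hx
  obtain ⟨C, hCc, hCl, hCcov, hCf, hCs⟩ := hclose
  rcases isEmpty_or_nonempty X with hX | ⟨⟨x₀⟩⟩
  · exact ⟨⟨fun x => (hX.false x).elim, continuous_of_const fun x => (hX.false x).elim⟩,
      fun a => (hX.false a.1).elim, fun x => (hX.false x).elim⟩
  obtain ⟨z₀, -⟩ := hsurj (g x₀)
  obtain ⟨g', hg'c, hg'A, hg'm⟩ := strat hdim C hCc hCl hCcov hCf (fun j => p ⁻¹' F j)
    (by
      intro s hs ⟨x, hx⟩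
      rcases hAE.2 (s : Set J) hs with he | hae
      · exfalso
        obtain ⟨z, hz⟩ := hsurj (g x)
        refine (eq_empty_iff_forall_notMem.1 he z) ?_
        refine mem_iInter₂.2 fun i hi => ?_
        rw [mem_preimage, hz]
        exact hCs i (mem_CS.1 hx i hi)
      · exact isAE_universe hae)
    A hA (fun x => if hx : x ∈ A then g₀ ⟨x, hx⟩ else z₀)
    (by
      rw [continuousOn_iff_continuous_domRestrict]
      have : A.domRestrict (fun x => if hx : x ∈ A then g₀ ⟨x, hx⟩ else z₀) = g₀ := by
        funext y
        simp [y.2]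
      rw [this]
      exact g₀.continuous)
    (by
      intro j x hx hxj
      simp only [hx, dite_true, mem_preimage]
      rw [hg ⟨x, hx⟩]
      exact hCs j hxj)
  refine ⟨⟨g', hg'c⟩, fun a => ?_, fun x => ?_⟩
  · have := hg'A a.2
    simpa [a.2] using this
  · obtain ⟨j, hj⟩ := hCcov x
    have h1 : g x ∈ F j := hCs j hj
    have h2 : p (g' x) ∈ F j := hg'm j hj
    exact (Metric.edist_le_ediam_of_mem h1 h2).trans (le_iSup (fun i => Metric.ediam (F i)) j)

def itg {Z : ℕ → Type*} {X : Type*} (p : ∀ i, Z (i + 1) → Z i) (g : ∀ i, X → Z i) :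
    ℕ → ∀ i, X → Z i
  | 0 => g
  | k + 1 => fun i x => p i (itg p g k (i + 1) x)

end LiftAux

/-- **lift to the inverse limit.** Under conditions (A)–(E) on an inverse
sequence of complete metric spaces with surjective `1`-Lipschitz bonding maps and covers
`ℱ_i` (open, or closed locally finite locally finite-dimensional) with `AE(n)` pull-backs
and summable meshes, every partial lift `g₀ : A → Z` (on a closed subset of an at most
`n`-dimensional metric space `X`) of a map `f : X → Z₁` extends to a map `g : X → Z`. -/
theorem statement11 (n : ℕ) (Z : ℕ → Type*) [∀ i, MetricSpace (Z i)]
    (hcomp : ∀ i, CompleteSpace (Z i))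
    (p : ∀ i, Z (i + 1) → Z i)
    (hsurj : ∀ i, Function.Surjective (p i))
    (hlip : ∀ i, LipschitzWith 1 (p i))
    (ι : ℕ → Type*) (F : ∀ i, ι i → Set (Z i))
    (hcov : ∀ i, IsCover (F i))
    (halt : ∀ i, (∀ j, IsOpen (F i j)) ∨
      ((∀ j, IsClosed (F i j)) ∧ LocallyFinite (F i) ∧ LocallyFinDimCover (F i)))
    (hAE : ∀ i, IsAECover.{u} n (fun j => p i ⁻¹' F i j))
    (hmesh : ∑' i, coverMesh (F i) < ⊤)
    {X : Type*} [MetricSpace X] (hdim : CovDimLE X n)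
    (f : C(X, Z 0)) (A : Set X) (hA : IsClosed A)
    (g₀ : C(A, {z : ∀ i, Z i // ∀ i, p i (z (i + 1)) = z i}))
    (hlift : ∀ a : A, (g₀ a).1 0 = f ↑a) :
    ∃ g : C(X, {z : ∀ i, Z i // ∀ i, p i (z (i + 1)) = z i}),
      ∀ a : A, g ↑a = g₀ a := by
  let gc : ∀ i, C(A, Z i) := fun i =>
    ⟨fun a => (g₀ a).1 i, (continuous_apply i).comp (continuous_subtype_val.comp g₀.continuous)⟩
  have hstep : ∀ i, ∀ g : {g : C(X, Z i) // ∀ a : A, g a.1 = (g₀ a).1 i},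
      ∃ g' : {g : C(X, Z (i + 1)) // ∀ a : A, g a.1 = (g₀ a).1 (i + 1)},
        ∀ x, edist (g.1 x) (p i (g'.1 x)) ≤ coverMesh (F i) := by
    intro i g
    obtain ⟨g', h1, h2⟩ := LiftAux.one_step (p i) (hsurj i) (F i) (hcov i) (halt i) (hAE i) hdim
      A hA g.1 (gc (i + 1)) (fun a => by rw [g.2 a]; exact (g₀ a).2 i)
    exact ⟨⟨g', h1⟩, h2⟩
  choose next hnext using hstep
  let G : ∀ i, {g : C(X, Z i) // ∀ a : A, g a.1 = (g₀ a).1 i} := fun i =>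
    Nat.rec ⟨f, fun a => (hlift a).symm⟩ (fun i g => next i g) i
  have hG : ∀ i x, edist ((G i).1 x) (p i ((G (i + 1)).1 x)) ≤ coverMesh (F i) :=
    fun i x => hnext i (G i) x
  let H := LiftAux.itg p (fun i x => (G i).1 x)
  have hHc : ∀ k i, Continuous (H k i) := by
    intro k
    induction k with
    | zero => exact fun i => (G i).1.continuous
    | succ k ih => exact fun i => (hlip i).continuous.comp (ih (i + 1))
  have hHA : ∀ k i, ∀ a : A, H k i a.1 = (g₀ a).1 i := by
    intro k
    induction k with
    | zero => exact fun i a => (G i).2 a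
    | succ k ih =>
      intro i a
      show p i (H k (i + 1) a.1) = _
      rw [ih (i + 1) a]
      exact (g₀ a).2 i
  have hHd : ∀ k i x, edist (H k i x) (H (k + 1) i x) ≤ coverMesh (F (k + i)) := by
    intro k
    induction k with
    | zero =>
      intro i x
      have h1 := hG i x
      rw [show coverMesh (F i) = coverMesh (F (0 + i)) by rw [Nat.zero_add]] at h1
      exact h1
    | succ k ih =>
      intro i x
      have h1 := (hlip i).edist_le_mul (H k (i + 1) x) (H (k + 1) (i + 1) x)
      rw [ENNReal.coe_one, one_mul] at h1
      have h2 := ih (i + 1) x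
      rw [show k + (i + 1) = k + 1 + i by omega] at h2
      exact h1.trans h2
  have hsum : ∀ i, ∑' k, coverMesh (F (k + i)) ≠ ⊤ := fun i =>
    ((ENNReal.tsum_comp_le_tsum_of_injective (add_left_injective i)
      (fun k => coverMesh (F k))).trans_lt hmesh).ne
  have hlim : ∀ i x, ∃ z, Filter.Tendsto (fun k => H k i x) Filter.atTop (nhds z) := fun i x =>
    cauchySeq_tendsto_of_complete
      (cauchySeq_of_edist_le_of_tsum_ne_top _ (fun k => hHd k i x) (hsum i))
  choose h hh using hlim
  have hcont : ∀ i, Continuous (h i) := by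
    intro i
    have hu : TendstoUniformly (fun k => H k i) (h i) Filter.atTop := by
      rw [EMetric.tendstoUniformly_iff]
      intro ε hε
      have ht := ENNReal.tendsto_sum_nat_add (fun k => coverMesh (F (k + i))) (hsum i)
      filter_upwards [ht.eventually (gt_mem_nhds hε)] with k hk x
      have := edist_le_tsum_of_edist_le_of_tendsto _ (fun k => hHd k i x) (hh i x) k
      rw [edist_comm]
      refine this.trans_lt ?_
      have he : (fun m => coverMesh (F (k + m + i))) = fun m => coverMesh (F (m + k + i)) := by
        funext m
        rw [add_comm k m]
      rw [he]
      exact hk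
    exact hu.continuous (Filter.Eventually.of_forall fun k => hHc k i).frequently
  have hthread : ∀ x i, p i (h (i + 1) x) = h i x := by
    intro x i
    have h1 := ((hlip i).continuous.tendsto _).comp (hh (i + 1) x)
    have h2 := (hh i x).comp (Filter.tendsto_add_atTop_nat 1)
    exact tendsto_nhds_unique h1 h2
  refine ⟨⟨fun x => ⟨fun i => h i x, hthread x⟩,
    Continuous.subtype_mk (continuous_pi hcont) _⟩, fun a => ?_⟩
  apply Subtype.ext
  funext i
  have h1 := hh i a.1
  simp only [hHA] at h1
  exact tendsto_nhds_unique h1 tendsto_const_nhds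
end

section
/- Let Z = lim←(Z₁ ←p₁ Z₂ ←p₂ ···) be an inverse limit with a cover ℱ_i of each Z_i satisfying: (A) each Z_i is a complete metric space; (B) each bonding map p_i: Z_{i+1} → Z_i is surjective and 1-Lipschitz; (C) each ℱ_i is either an open cover or a closed, locally finite, locally finite-dimensional cover; (D) each pull-back p_i^{-1}(ℱ_i) is an AE(n)-cover; (E) Σ_i mesh ℱ_i < ∞. If Z₁ is an ANE(n), then Z is an ANE(n). -/
open Set Metric unitInterval
open scoped ENNReal Classical

universe u

theorem covDimLE_closed {W : Type*} [TopologicalSpace W] {n : ℕ} (hW : CovDimLE W n)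
    (C : Set W) (hC : IsClosed C) : CovDimLE C n := by
  intro U hUo hUc
  obtain ⟨R, hRo, hRc, hRr, hRn⟩ := hW ({v | IsOpen v ∧ (Subtype.val ⁻¹' v : Set C) ∈ U} ∪ {Cᶜ})
    (by
      rintro u (hu | hu)
      · exact hu.1
      · rw [mem_singleton_iff.1 hu]; exact hC.isOpen_compl)
    (by
      refine eq_univ_of_forall fun x => ?_
      by_cases hx : x ∈ C
      · have : (⟨x, hx⟩ : C) ∈ ⋃₀ U := by rw [hUc]; trivial
        obtain ⟨u, hu, hxu⟩ := this
        obtain ⟨v, hv, rfl⟩ := isOpen_induced_iff.1 (hUo u hu)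
        exact ⟨v, Or.inl ⟨hv, hu⟩, hxu⟩
      · exact ⟨Cᶜ, Or.inr rfl, hx⟩)
  refine ⟨{r | r.Nonempty ∧ r ∈ (fun r => (Subtype.val ⁻¹' r : Set C)) '' R}, ?_, ?_, ?_, ?_⟩
  · rintro _ ⟨_, r, hr, rfl⟩
    exact (hRo r hr).preimage continuous_subtype_val
  · refine eq_univ_of_forall fun x => ?_
    have : (x : W) ∈ ⋃₀ R := by rw [hRc]; trivial
    obtain ⟨r, hr, hxr⟩ := this
    exact ⟨Subtype.val ⁻¹' r, ⟨⟨x, hxr⟩, r, hr, rfl⟩, hxr⟩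
  · rintro _ ⟨⟨x, hx⟩, r, hr, rfl⟩
    obtain ⟨u, hu | hu, hru⟩ := hRr r hr
    · exact ⟨_, hu.2, preimage_mono hru⟩
    · rw [mem_singleton_iff.1 hu] at hru
      exact absurd x.2 (hru hx)
  · intro x
    have hsub : {r | r ∈ {r | r.Nonempty ∧ r ∈ (fun r => (Subtype.val ⁻¹' r : Set C)) '' R} ∧ x ∈ r}
        ⊆ (fun r => (Subtype.val ⁻¹' r : Set C)) '' {r ∈ R | (x : W) ∈ r} := by
      rintro _ ⟨⟨_, r, hr, rfl⟩, hx⟩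
      exact ⟨r, ⟨hr, hx⟩, rfl⟩
    have hf := (hRn x).1
    exact ⟨(hf.image _).subset hsub,
      (ncard_le_ncard hsub (hf.image _)).trans ((ncard_image_le hf).trans (hRn x).2)⟩

theorem ae_ext {n : ℕ} {X : Type*} [TopologicalSpace X] (P : Set X) (hP : IsAE.{u} n P)
    {W : Type u} [MetricSpace W] (hW : CovDimLE W n) (B D : Set W) (hB : IsClosed B)
    (hD : IsClosed D) (h : W → X) (hc : ContinuousOn h D) (hm : ∀ x ∈ D, x ∈ B → h x ∈ P) :
    ∃ h' : W → X, ContinuousOn h' B ∧ (∀ x ∈ B, h' x ∈ P) ∧ ∀ x ∈ D, h' x = h x := by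
  obtain ⟨g, hg⟩ := hP B (covDimLE_closed hW B hB) (Subtype.val ⁻¹' D)
    (hD.preimage continuous_subtype_val)
    ⟨fun a => ⟨h a.1.1, hm _ a.2 a.1.2⟩, by
      refine Continuous.subtype_mk ?_ _
      exact hc.comp_continuous (continuous_subtype_val.comp continuous_subtype_val) fun a => a.2⟩
  refine ⟨fun x => if hx : x ∈ B then (g ⟨x, hx⟩ : X) else h x, ?_, ?_, ?_⟩
  · rw [continuousOn_iff_continuous_domRestrict]
    have : B.domRestrict (fun x => if hx : x ∈ B then (g ⟨x, hx⟩ : X) else h x)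
        = fun x => (g x : X) := by
      ext x; simp [Set.domRestrict]
    rw [this]
    fun_prop
  · intro x hx
    simp [hx]
  · intro x hx
    by_cases hxB : x ∈ B
    · simp only [hxB, dif_pos]
      rw [hg ⟨⟨x, hxB⟩, hx⟩]; rfl
    · simp [hxB]

theorem carrier_closed {n : ℕ} {X : Type*} [TopologicalSpace X]
    {W : Type u} [MetricSpace W] (hW : CovDimLE W n) {κ : Type*} (G : κ → Set W)
    (hGc : ∀ j, IsClosed (G j)) (hGl : LocallyFinite G) (hGd : LocallyFinDimCover G)
    (hGu : IsCover G) (P : κ → Set X)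
    (hP : ∀ S : Finset κ, S.Nonempty → (⋂ j ∈ S, G j).Nonempty → IsAE.{u} n (⋂ j ∈ S, P j : Set X))
    (A : Set W) (hA : IsClosed A) (f : W → X) (hf : ContinuousOn f A)
    (hfP : ∀ x ∈ A, ∀ j, x ∈ G j → f x ∈ P j) :
    ∃ h : W → X, Continuous h ∧ (∀ x ∈ A, h x = f x) ∧ ∀ x j, x ∈ G j → h x ∈ P j := by
  let GS : Finset κ → Set W := fun S => ⋂ j ∈ S, G j
  have GSc : ∀ S, IsClosed (GS S) := fun S => isClosed_biInter fun j _ => hGc j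
  have GSl : LocallyFinite GS := by
    intro x
    obtain ⟨t, ht, hfin⟩ := hGl x
    refine ⟨t, ht, ?_⟩
    refine (hfin.toFinset.powerset.finite_toSet).subset ?_
    rintro S ⟨y, hy, hyt⟩
    simp only [Finset.coe_powerset, mem_preimage, mem_powerset_iff]
    intro j hj
    simp only [Finite.coe_toFinset, mem_setOf_eq]
    exact ⟨y, by simpa using mem_iInter₂.1 hy j hj, hyt⟩
  let D : Set (Finset κ) → Set W := fun 𝒮 => A ∪ ⋃ S : 𝒮, GS S
  have Dcl : ∀ 𝒮, IsClosed (D 𝒮) := fun 𝒮 =>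
    hA.union ((GSl.comp_injective Subtype.val_injective).isClosed_iUnion fun S => GSc _)
  have Dco : ∀ 𝒮 (h : W → X), ContinuousOn h A → (∀ S ∈ 𝒮, ContinuousOn h (GS S)) →
      ContinuousOn h (D 𝒮) := fun 𝒮 h h1 h2 =>
    h1.union_of_isClosed ((GSl.comp_injective Subtype.val_injective).continuousOn_iUnion
      (fun S => GSc _) (fun S => h2 _ S.2)) hA
      ((GSl.comp_injective Subtype.val_injective).isClosed_iUnion fun S => GSc _)
  have DA : ∀ 𝒮, A ⊆ D 𝒮 := fun 𝒮 => subset_union_left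
  have DG : ∀ 𝒮, ∀ S ∈ 𝒮, GS S ⊆ D 𝒮 := fun 𝒮 S hS =>
    (subset_iUnion (fun S : 𝒮 => GS S) ⟨S, hS⟩).trans subset_union_right
  have Dmono : ∀ 𝒮 𝒯, 𝒮 ⊆ 𝒯 → D 𝒮 ⊆ D 𝒯 := by
    rintro 𝒮 𝒯 hst x (hx | hx)
    · exact DA _ hx
    · obtain ⟨S, hS⟩ := mem_iUnion.1 hx
      exact DG _ _ (hst S.2) hS
  let Q := {q : Set (Finset κ) × (W → X) // ContinuousOn q.2 (D q.1) ∧ (∀ x ∈ A, q.2 x = f x) ∧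
    ∀ x ∈ D q.1, ∀ j, x ∈ G j → q.2 x ∈ P j}
  let r : Q → Q → Prop := fun a b => a.1.1 ⊆ b.1.1 ∧ ∀ x ∈ D a.1.1, b.1.2 x = a.1.2 x
  obtain ⟨⟨⟨𝒮, h⟩, hco, hhA, hhP⟩, hmax⟩ : ∃ m : Q, ∀ a, r m a → r a m := by
    refine exists_maximal_of_chains_bounded ?_ ?_
    · intro c hc
      let H : W → X := fun x => if hx : ∃ a ∈ c, x ∈ D a.1.1 then hx.choose.1.2 x else f x
      have HA : ∀ x ∈ A, H x = f x := by
        intro x hx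
        by_cases hx' : ∃ a ∈ c, x ∈ D a.1.1
        · simp only [H, dif_pos hx']
          exact hx'.choose.2.2.1 x hx
        · simp only [H, dif_neg hx']
      have Hc : ∀ a ∈ c, ∀ x ∈ D a.1.1, H x = a.1.2 x := by
        intro a ha x hx
        have hx' : ∃ a ∈ c, x ∈ D a.1.1 := ⟨a, ha, hx⟩
        simp only [H, dif_pos hx']
        obtain ⟨hb, hxb⟩ := hx'.choose_spec
        rcases eq_or_ne hx'.choose a with e | e
        · rw [e]
        · rcases hc hb ha e with hr | hr
          · exact (hr.2 x hxb).symm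
          · exact hr.2 x hx
      refine ⟨⟨⟨⋃ a ∈ c, a.1.1, H⟩, ?_, HA, ?_⟩, ?_⟩
      · refine Dco _ _ (hf.congr HA) ?_
        intro S hS
        obtain ⟨a, ha, hSa⟩ := mem_iUnion₂.1 hS
        exact (a.2.1.mono (DG _ _ hSa)).congr fun x hx => Hc a ha x (DG _ _ hSa hx)
      · rintro x (hx | hx) j hj
        · change H x ∈ P j
          rw [HA x hx]; exact hfP x hx j hj
        · obtain ⟨⟨S, hS⟩, hxS⟩ := mem_iUnion.1 hx
          obtain ⟨a, ha, hSa⟩ := mem_iUnion₂.1 hS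
          change H x ∈ P j
          rw [Hc a ha x (DG _ _ hSa hxS)]
          exact a.2.2.2 x (DG _ _ hSa hxS) j hj
      · intro a ha
        exact ⟨subset_biUnion_of_mem (u := fun a : Q => a.1.1) ha, Hc a ha⟩
    · rintro a b c ⟨h1, h2⟩ ⟨h3, h4⟩
      exact ⟨h1.trans h3, fun x hx => (h4 x (Dmono _ _ h1 hx)).trans (h2 x hx)⟩
  have key : ∀ j, (G j).Nonempty → ({j} : Finset κ) ∈ 𝒮 := by
    intro j hj
    by_contra hj𝒮
    obtain ⟨N, hN⟩ := hGd j
    let good : ℕ → Prop := fun k => ∃ S : Finset κ, j ∈ S ∧ S ∉ 𝒮 ∧ (GS S).Nonempty ∧ S.card = k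
    have hg1 : good 1 := ⟨{j}, by simp, hj𝒮, by simpa [GS] using hj, by simp⟩
    have hgb : ∀ k, good k → k ≤ N := by
      rintro k ⟨S, h1, h2, h3, rfl⟩
      exact hN S h1 h3
    obtain ⟨S, hjS, hS𝒮, hSne, hScard⟩ : good (Nat.findGreatest good N) :=
      Nat.findGreatest_spec (hgb 1 hg1) hg1
    have hbig : ∀ i ∉ S, ∀ x ∈ GS S, x ∈ G i → x ∈ D 𝒮 := by
      intro i hi x hx hxi
      have hxT : x ∈ GS (insert i S) := by
        simp only [GS, Finset.mem_insert, iInter_iInter_eq_or_left]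
        exact ⟨hxi, hx⟩
      by_cases hT : insert i S ∈ 𝒮
      · exact DG _ _ hT hxT
      · exfalso
        have hgT : good (insert i S).card := ⟨insert i S, by simp [hjS], hT, ⟨x, hxT⟩, rfl⟩
        have := Nat.le_findGreatest (hgb _ hgT) hgT
        rw [← hScard, Finset.card_insert_of_notMem hi] at this
        omega
    obtain ⟨h', h1, h2, h3⟩ := ae_ext _ (hP S ⟨j, hjS⟩ hSne) hW (GS S) (D 𝒮) (GSc S) (Dcl 𝒮) h hco
      (fun x hx hxS => mem_iInter₂.2 fun i hi => hhP x hx i (mem_iInter₂.1 hxS i hi))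
    have hDi : D (insert S 𝒮) ⊆ D 𝒮 ∪ GS S := by
      rintro x (hx | hx)
      · exact Or.inl (DA _ hx)
      · obtain ⟨⟨T, hT⟩, hxT⟩ := mem_iUnion.1 hx
        rcases hT with rfl | hT
        · exact Or.inr hxT
        · exact Or.inl (DG _ _ hT hxT)
    have hr := hmax ⟨⟨insert S 𝒮, h'⟩, ?_, ?_, ?_⟩ ⟨subset_insert _ _, h3⟩
    · exact hS𝒮 (hr.1 (mem_insert _ _))
    · exact ((hco.congr h3).union_of_isClosed h1 (Dcl _) (GSc _)).mono hDi
    · intro x hx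
      exact (h3 x (DA _ hx)).trans (hhA x hx)
    · intro x hx i hi
      change h' x ∈ P i
      by_cases hxD : x ∈ D 𝒮
      · rw [h3 x hxD]; exact hhP x hxD i hi
      · have hxS : x ∈ GS S := (hDi hx).resolve_left hxD
        by_cases hiS : i ∈ S
        · exact mem_iInter₂.1 (h2 x hxS) i hiS
        · exact absurd (hbig i hiS x hxS hi) hxD
  have hall : ∀ x, x ∈ D 𝒮 := by
    intro x
    have : x ∈ ⋃ j, G j := by rw [hGu]; trivial
    obtain ⟨j, hj⟩ := mem_iUnion.1 this
    exact DG _ _ (key j ⟨x, hj⟩) (by simpa [GS] using hj)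
  refine ⟨h, ?_, hhA, fun x j hj => hhP x (hall x) j hj⟩
  rw [← continuousOn_univ]
  exact hco.mono fun x _ => hall x

theorem approx_lift {n : ℕ} {X X' : Type*} [TopologicalSpace X] [TopologicalSpace X']
    {W : Type u} [MetricSpace W] (hW : CovDimLE W n) {κ : Type*} (F : κ → Set X)
    (hcov : IsCover F) (halt : (∀ j, IsOpen (F j)) ∨
      ((∀ j, IsClosed (F j)) ∧ LocallyFinite F ∧ LocallyFinDimCover F))
    (p : X' → X) (hsurj : Function.Surjective p)
    (hAE : IsAECover.{u} n (fun j => p ⁻¹' F j)) (g : C(W, X))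
    (A : Set W) (hA : IsClosed A) (f : C(A, X')) (hfg : ∀ a : A, p (f a) = g a) :
    ∃ h : C(W, X'), (∀ a : A, h a = f a) ∧ ∀ w, ∃ j, g w ∈ F j ∧ p (h w) ∈ F j := by
  rcases isEmpty_or_nonempty W with hE | ⟨⟨w0⟩⟩
  · exact ⟨⟨fun w => hE.elim w, continuous_of_const fun w => hE.elim w⟩, fun a => hE.elim a,
      fun w => hE.elim w⟩
  obtain ⟨z0, -⟩ := hsurj (g w0)
  have hcov' : ∀ z, ∃ j, z ∈ F j := fun z => by
    have : z ∈ ⋃ j, F j := by rw [hcov]; trivial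
    exact mem_iUnion.1 this
  let f' : W → X' := fun w => if hw : w ∈ A then f ⟨w, hw⟩ else z0
  have hf'A : ∀ a : A, f' a = f a := fun a => by simp [f']
  have hf'c : ContinuousOn f' A := by
    rw [continuousOn_iff_continuous_domRestrict]
    have : A.domRestrict f' = f := funext hf'A
    rw [this]; exact f.continuous
  have hf'p : ∀ x ∈ A, p (f' x) = g x := fun x hx => by
    rw [hf'A ⟨x, hx⟩, hfg]
  have hAE' : ∀ J : Set κ, J.Nonempty → (⋂ j ∈ J, g ⁻¹' F j).Nonempty →
      IsAE.{u} n (⋂ j ∈ J, p ⁻¹' F j : Set X') := by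
    rintro J hJ ⟨w, hw⟩
    refine (hAE.2 J hJ).resolve_left ?_
    obtain ⟨z, hz⟩ := hsurj (g w)
    refine Set.Nonempty.ne_empty ⟨z, mem_iInter₂.2 fun j hj => ?_⟩
    have := mem_iInter₂.1 hw j hj
    rw [mem_preimage] at this ⊢
    rwa [hz]
  rcases halt with hop | ⟨hcl, hlf, hld⟩
  · obtain ⟨R, hRo, hRc, hRr, hRn⟩ := hW (range fun j => g ⁻¹' F j)
      (by rintro _ ⟨j, rfl⟩; exact (hop j).preimage g.continuous)
      (by
        refine eq_univ_of_forall fun w => ?_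
        obtain ⟨j, hj⟩ := hcov' (g w)
        exact ⟨_, ⟨j, rfl⟩, hj⟩)
    obtain ⟨v, hvo, hvu, hvl, hvs⟩ := precise_refinement (fun r : R => (r : Set W))
      (fun r => hRo r r.2) (by rw [← sUnion_eq_iUnion, hRc])
    obtain ⟨G, hGu, hGc, hGs⟩ := exists_iUnion_eq_closed_subset hvo (fun x => hvl.point_finite x) hvu
    have hR' : ∀ r : R, ∃ j, (r : Set W) ⊆ g ⁻¹' F j := by
      rintro ⟨r, hr⟩
      obtain ⟨_, ⟨j, rfl⟩, hj⟩ := hRr r hr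
      exact ⟨j, hj⟩
    choose φ hφ using hR'
    have hGφ : ∀ r, G r ⊆ g ⁻¹' F (φ r) := fun r => ((hGs r).trans (hvs r)).trans (hφ r)
    refine Exists.elim (carrier_closed hW G hGc (hvl.subset hGs) ?_ hGu
      (fun r => p ⁻¹' F (φ r)) ?_ A hA f' hf'c ?_) ?_
    rotate_right
    · rintro h ⟨hh, hhA, hhP⟩
      refine ⟨⟨h, hh⟩, fun a => (hhA a a.2).trans (hf'A a), fun w => ?_⟩
      have : w ∈ ⋃ r, G r := by rw [hGu]; trivial
      obtain ⟨r, hr⟩ := mem_iUnion.1 this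
      exact ⟨φ r, hGφ r hr, hhP w r hr⟩
    · intro r
      refine ⟨n + 1, ?_⟩
      rintro S - ⟨x, hx⟩
      refine le_trans ?_ (hRn x).2
      have : ((↑) '' (S : Set R) : Set (Set W)) ⊆ {r ∈ R | x ∈ r} := by
        rintro _ ⟨r, hr, rfl⟩
        exact ⟨r.2, hvs r (hGs r (mem_iInter₂.1 hx r hr))⟩
      have h2 := ncard_le_ncard this (hRn x).1
      rwa [ncard_image_of_injective _ Subtype.val_injective, ncard_coe_finset] at h2
    · rintro S hS ⟨x, hx⟩
      have := hAE' (φ '' S) (by simpa using hS)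
        ⟨x, by
          rw [biInter_image]
          exact mem_iInter₂.2 fun r hr => hGφ r (mem_iInter₂.1 hx r hr)⟩
      rw [biInter_image] at this
      exact this
    · intro x hx r hr
      rw [mem_preimage, hf'p x hx]
      exact hGφ r hr
  · refine Exists.elim (carrier_closed hW (fun j => g ⁻¹' F j)
      (fun j => (hcl j).preimage g.continuous) (hlf.preimage_continuous g.continuous) ?_ ?_
      (fun j => p ⁻¹' F j) (fun S hS hne => hAE' S hS hne) A hA f' hf'c ?_) ?_
    rotate_right
    · rintro h ⟨hh, hhA, hhP⟩
      refine ⟨⟨h, hh⟩, fun a => (hhA a a.2).trans (hf'A a), fun w => ?_⟩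
      obtain ⟨j, hj⟩ := hcov' (g w)
      exact ⟨j, hj, hhP w j hj⟩
    · intro j
      obtain ⟨N, hN⟩ := hld j
      refine ⟨N, fun S hjS hne => hN S hjS ?_⟩
      obtain ⟨x, hx⟩ := hne
      exact ⟨g x, mem_iInter₂.2 fun i hi => mem_iInter₂.1 hx i hi⟩
    · refine eq_univ_of_forall fun w => ?_
      obtain ⟨j, hj⟩ := hcov' (g w)
      exact mem_iUnion.2 ⟨j, hj⟩
    · intro x hx j hj
      rw [mem_preimage, hf'p x hx]
      exact hj

/-- The shift operator on families. -/
def shiftOp {Z : ℕ → Type*} (p : ∀ i, Z (i + 1) → Z i) (G : ∀ i, Z i) : ∀ i, Z i :=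
  fun i => p i (G (i + 1))

theorem shiftOp_edist {Z : ℕ → Type*} [∀ i, MetricSpace (Z i)] (p : ∀ i, Z (i + 1) → Z i)
    (hlip : ∀ i, LipschitzWith 1 (p i)) (k : ℕ) : ∀ (G G' : ∀ i, Z i) (i : ℕ),
    edist ((shiftOp p)^[k] G i) ((shiftOp p)^[k] G' i) ≤ edist (G (i + k)) (G' (i + k)) := by
  induction k with
  | zero => intro G G' i; exact le_rfl
  | succ k ih =>
    intro G G' i
    rw [Function.iterate_succ_apply, Function.iterate_succ_apply]
    refine (ih _ _ i).trans ?_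
    have := hlip (i + k) (G (i + k + 1)) (G' (i + k + 1))
    rw [ENNReal.coe_one, one_mul] at this
    exact this

/-- Under conditions (A)–(E) on an inverse sequence of complete metric
spaces with surjective `1`-Lipschitz bonding maps and covers `ℱ_i` (open, or closed
locally finite locally finite-dimensional) with `AE(n)` pull-backs and summable meshes:
if `Z₁` is an `ANE(n)`, then the inverse limit `Z` is an `ANE(n)`. -/
theorem statement12 (n : ℕ) (Z : ℕ → Type*) [∀ i, MetricSpace (Z i)]
    (hcomp : ∀ i, CompleteSpace (Z i))
    (p : ∀ i, Z (i + 1) → Z i)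
    (hsurj : ∀ i, Function.Surjective (p i))
    (hlip : ∀ i, LipschitzWith 1 (p i))
    (ι : ℕ → Type*) (F : ∀ i, ι i → Set (Z i))
    (hcov : ∀ i, IsCover (F i))
    (halt : ∀ i, (∀ j, IsOpen (F i j)) ∨
      ((∀ j, IsClosed (F i j)) ∧ LocallyFinite (F i) ∧ LocallyFinDimCover (F i)))
    (hAE : ∀ i, IsAECover.{u} n (fun j => p i ⁻¹' F i j))
    (hmesh : ∑' i, coverMesh (F i) < ⊤)
    (hZ1 : IsANE.{u} n (Z 0)) :
    IsANE.{u} n {z : ∀ i, Z i // ∀ i, p i (z (i + 1)) = z i} := by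
  have hpc : ∀ i, Continuous (p i) := fun i => (hlip i).continuous
  intro Y _ hY A hA f
  obtain ⟨U, hU, hAU, g, hg⟩ := hZ1 Y hY A hA
    ⟨fun a => (f a).1 0, (continuous_apply 0).comp (continuous_subtype_val.comp f.continuous)⟩
  obtain ⟨V, hV, hAV, hVU⟩ := normal_exists_closure_subset hA hU hAU
  have hW : CovDimLE (closure V) n := covDimLE_closed hY _ isClosed_closure
  let B : Set (closure V) := Subtype.val ⁻¹' A
  have hB : IsClosed B := hA.preimage continuous_subtype_val
  let fB : ∀ i, C(B, Z i) := fun i => ⟨fun b => (f ⟨b.1.1, b.2⟩).1 i, by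
    refine (continuous_apply i).comp (continuous_subtype_val.comp (f.continuous.comp ?_))
    exact (continuous_subtype_val.comp continuous_subtype_val).subtype_mk _⟩
  have hfB : ∀ i b, p i (fB (i + 1) b) = fB i b := fun i b => (f ⟨b.1.1, b.2⟩).2 i
  let T : ℕ → Type _ := fun i => {g : C(closure V, Z i) // ∀ b : B, g b = fB i b}
  have step : ∀ i (g : T i), ∃ h : T (i + 1), ∀ w, ∃ j, g.1 w ∈ F i j ∧ p i (h.1 w) ∈ F i j := by
    intro i g
    obtain ⟨h, h1, h2⟩ := approx_lift hW (F i) (hcov i) (halt i) (p i) (hsurj i) (hAE i) g.1 B hB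
      (fB (i + 1)) (fun b => by rw [hfB, g.2])
    exact ⟨⟨h, h1⟩, h2⟩
  choose next hnext using step
  let g0 : T 0 := ⟨⟨fun w => g ⟨w.1, hVU w.2⟩, by fun_prop⟩, fun b => hg b.1.1 b.2⟩
  let GG : ∀ i, T i := fun i => Nat.rec g0 (fun i g => next i g) i
  have hGG : ∀ i w, ∃ j, (GG i).1 w ∈ F i j ∧ p i ((GG (i + 1)).1 w) ∈ F i j :=
    fun i w => hnext i (GG i) w
  let Φ := shiftOp p
  let q : ℕ → closure V → ∀ i, Z i := fun k w => Φ^[k] fun i => (GG i).1 w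
  have hqs : ∀ k w i, q (k + 1) w i = p i (q k w (i + 1)) := by
    intro k w i
    simp only [q, Function.iterate_succ_apply']
    rfl
  have hqc : ∀ k i, Continuous fun w => q k w i := by
    intro k
    induction k with
    | zero => intro i; exact (GG i).1.continuous
    | succ k ih =>
      intro i
      simp only [hqs]
      exact (hpc i).comp (ih (i + 1))
  let d : ℕ → ℕ → ℝ≥0∞ := fun i k => coverMesh (F (i + k))
  have hd : ∀ i, tsum (d i) ≠ ⊤ := by
    intro i
    refine ne_top_of_le_ne_top hmesh.ne ?_
    exact ENNReal.tsum_comp_le_tsum_of_injective (add_right_injective i) fun k => coverMesh (F k)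
  have hqd : ∀ i w k, edist (q k w i) (q k.succ w i) ≤ d i k := by
    intro i w k
    simp only [q, Function.iterate_succ_apply]
    refine (shiftOp_edist p hlip k _ _ i).trans ?_
    obtain ⟨j, h1, h2⟩ := hGG (i + k) w
    exact (Metric.edist_le_ediam_of_mem h1 h2).trans
      (le_iSup (fun j => EMetric.diam (F (i + k) j)) j)
  have hlim : ∀ w i, ∃ z, Filter.Tendsto (fun k => q k w i) Filter.atTop (nhds z) := by
    intro w i
    have := hcomp i
    exact cauchySeq_tendsto_of_complete
      (cauchySeq_of_edist_le_of_tsum_ne_top (d i) (hqd i w) (hd i))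
  choose L hL using hlim
  have hLc : ∀ i, Continuous fun w => L w i := by
    intro i
    have hu : TendstoUniformly (fun k w => q k w i) (fun w => L w i) Filter.atTop := by
      rw [EMetric.tendstoUniformly_iff]
      intro ε hε
      filter_upwards [(ENNReal.tendsto_sum_nat_add (d i) (hd i)).eventually (gt_mem_nhds hε)]
        with k hk w
      rw [edist_comm]
      refine (edist_le_tsum_of_edist_le_of_tendsto (d i) (hqd i w) (hL w i) k).trans_lt ?_
      simpa only [add_comm k] using hk
    exact hu.continuous (Filter.Eventually.of_forall fun k => hqc k i).frequently
  have hLp : ∀ w i, p i (L w (i + 1)) = L w i := by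
    intro w i
    have h1 := ((hpc i).tendsto _).comp (hL w (i + 1))
    have h2 := (hL w i).comp (Filter.tendsto_add_atTop_nat 1)
    refine tendsto_nhds_unique h1 (h2.congr fun k => ?_)
    exact hqs k w i
  have hLB : ∀ (b : B) i, L b i = fB i b := by
    intro b i
    have hq : ∀ k i, q k b i = fB i b := by
      intro k
      induction k with
      | zero => intro i; exact (GG i).2 b
      | succ k ih => intro i; rw [hqs, ih, hfB]
    refine tendsto_nhds_unique (hL b i) ?_
    simp only [hq]
    exact tendsto_const_nhds
  refine ⟨V, hV, hAV, ⟨fun y => ⟨L ⟨y.1, subset_closure y.2⟩, hLp _⟩, ?_⟩, ?_⟩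
  · refine Continuous.subtype_mk (continuous_pi fun i => ?_) _
    exact (hLc i).comp (continuous_subtype_val.subtype_mk _)
  · intro a ha
    apply Subtype.ext
    funext i
    exact hLB ⟨⟨a, subset_closure (hAV ha)⟩, ha⟩ i
end

section
/- Every locally finite-dimensional polyhedron (a locally finite-dimensional simplicial complex endowed with the metric topology) is a complete metric space and an ANE(∞), i.e. an absolute neighborhood extensor for the class of all metric spaces. -/
open Set Metric unitInterval
open scoped ENNReal Classical

universe u

open Filter Topology in
/-- Dugundji extension theorem. -/
lemma aux_dugundji {Y E : Type*} [MetricSpace Y] [NormedAddCommGroup E] [NormedSpace ℝ E]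
    (A : Set Y) (hA : IsClosed A) (hne : A.Nonempty) (f : A → E) (hf : Continuous f) :
    ∃ D : Y → E, Continuous D ∧ ∀ a : A, D a = f a := by
  have hpos : ∀ y : (Aᶜ : Set Y), 0 < infDist (y : Y) A := fun y =>
    (hA.notMem_iff_infDist_pos hne).1 y.2
  obtain ⟨g, hg⟩ := exists_continuous_forall_mem_convex_of_local_const
    (X := (Aᶜ : Set Y)) (E := E)
    (t := fun y => convexHull ℝ (f '' {a : A | dist (a : Y) y < 2 * infDist (y : Y) A}))
    (fun y => convex_convexHull ℝ _) (by
      intro y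
      obtain ⟨a, ha, hay⟩ := (infDist_lt_iff hne (x := (y : Y)) (r := 2 * infDist (y : Y) A)).1
        (by linarith [hpos y])
      refine ⟨f ⟨a, ha⟩, ?_⟩
      have h1 : Continuous fun z : (Aᶜ : Set Y) => dist a (z : Y) := by fun_prop
      have h2 : Continuous fun z : (Aᶜ : Set Y) => 2 * infDist (z : Y) A :=
        continuous_const.mul ((continuous_infDist_pt A).comp continuous_subtype_val)
      have h3 : ∀ᶠ z : (Aᶜ : Set Y) in 𝓝 y, dist a (z : Y) < 2 * infDist (z : Y) A :=
        h1.continuousAt.eventually_lt h2.continuousAt (by rw [dist_comm]; exact hay)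
      filter_upwards [h3] with z hz
      exact subset_convexHull ℝ _ ⟨⟨a, ha⟩, hz, rfl⟩)
  refine ⟨fun y => if h : y ∈ A then f ⟨y, h⟩ else g ⟨y, h⟩, ?_, fun a => by simp⟩
  rw [continuous_iff_continuousAt]
  intro y
  by_cases hy : y ∈ A
  · rw [Metric.continuousAt_iff]
    intro ε hε
    obtain ⟨δ, hδ, H⟩ := Metric.continuousAt_iff.1 (hf.continuousAt (x := ⟨y, hy⟩)) ε hε
    refine ⟨δ / 3, by positivity, fun {z} hz => ?_⟩
    simp only [hy, dif_pos]
    by_cases hzA : z ∈ A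
    · simp only [hzA, dif_pos]
      exact H (x := ⟨z, hzA⟩) (by rw [Subtype.dist_eq]; simp only; linarith)
    · simp only [hzA, dif_neg, not_false_eq_true]
      rw [← Metric.mem_ball]
      refine (convexHull_min ?_ (convex_ball (f ⟨y, hy⟩) ε)) (hg ⟨z, hzA⟩)
      rintro _ ⟨a, ha, rfl⟩
      refine H ?_
      simp only [mem_setOf_eq] at ha
      have h1 := infDist_le_dist_of_mem (x := z) hy
      have h2 := dist_triangle (a : Y) z y
      rw [Subtype.dist_eq]
      simp only
      linarith
  · have h1 : ContinuousOn (fun y => if h : y ∈ A then f ⟨y, h⟩ else g ⟨y, h⟩) Aᶜ := by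
      rw [continuousOn_iff_continuous_restrict]
      convert g.continuous using 1
      ext z
      have : (z : Y) ∉ A := z.2
      simp [Set.restrict, this]
    exact h1.continuousAt (hA.isOpen_compl.mem_nhds hy)

lemma aux_summable {V : Type*} (x : lp (fun _ : V => ℝ) 1) : Summable fun v => |x v| := by
  have := (lp.hasSum_norm (p := 1) (by simp) x).summable
  simpa using this

lemma aux_norm {V : Type*} (x : lp (fun _ : V => ℝ) 1) : ‖x‖ = ∑' v, |x v| := by
  have := lp.norm_eq_tsum_rpow (p := 1) (by simp) x
  simpa using this

open Filter Topology in
lemma aux_dom {Y V : Type*} [TopologicalSpace Y] (D h : Y → lp (fun _ : V => ℝ) 1)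
    (hD : Continuous D) (hh : ∀ v, Continuous fun y => h y v)
    (hle : ∀ y v, |h y v| ≤ |D y v|) : Continuous h := by
  rw [continuous_iff_continuousAt]
  intro y0
  rw [ContinuousAt, tendsto_iff_norm_sub_tendsto_zero]
  have hq : Tendsto (fun y => ∑' v, min |h y v - h y0 v| (2 * |D y0 v|)) (𝓝 y0)
      (𝓝 (∑' v : V, (0 : ℝ))) := by
    refine tendsto_tsum_of_dominated_convergence (bound := fun v => 2 * |D y0 v|)
      ((aux_summable (D y0)).mul_left 2) ?_ ?_
    · intro v
      have : Continuous fun y => min |h y v - h y0 v| (2 * |D y0 v|) := by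
        have := hh v
        fun_prop
      have h2 := this.tendsto y0
      simpa using h2
    · refine Eventually.of_forall fun y v => ?_
      rw [Real.norm_eq_abs, abs_of_nonneg (by positivity)]
      exact min_le_right _ _
  have hD0 : Tendsto (fun y => ‖D y - D y0‖) (𝓝 y0) (𝓝 0) :=
    tendsto_iff_norm_sub_tendsto_zero.1 (hD.tendsto y0)
  have hs := hq.add hD0
  simp only [tsum_zero, add_zero] at hs
  refine squeeze_zero (fun _ => norm_nonneg _) (fun y => ?_) hs
  have s1 : Summable fun v => min |h y v - h y0 v| (2 * |D y0 v|) :=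
    Summable.of_nonneg_of_le (fun v => by positivity) (fun v => min_le_right _ _)
      ((aux_summable (D y0)).mul_left 2)
  have s2 := aux_summable (D y - D y0)
  rw [aux_norm (h y - h y0), aux_norm (D y - D y0), ← s1.tsum_add s2]
  refine (aux_summable (h y - h y0)).tsum_le_tsum (fun v => ?_) (s1.add s2)
  simp only [lp.coeFn_sub, Pi.sub_apply]
  rcases le_total |h y v - h y0 v| (2 * |D y0 v|) with h1 | h1
  · rw [min_eq_left h1]
    linarith [abs_nonneg (D y v - D y0 v)]
  · rw [min_eq_right h1]
    have := abs_sub (h y v) (h y0 v)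
    have := abs_sub_abs_le_abs_sub (D y v) (D y0 v)
    linarith [hle y v, hle y0 v]

lemma aux_face {V : Type*} (K : SComplex V) (hK : K.LocallyFiniteDimensional) (S : Set V)
    (hne : S.Nonempty)
    (hS : ∀ s : Finset V, s.Nonempty → (∀ v ∈ s, v ∈ S) → s ∈ K.faces) :
    ∃ s ∈ K.faces, ∀ v, v ∈ S → v ∈ s := by
  obtain ⟨v, hv⟩ := hne
  obtain ⟨N, hN⟩ := hK v (hS {v} (by simp) (by simpa using hv))
  have hfin : S.Finite := by
    by_contra hinf
    have hinf : S.Infinite := hinf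
    obtain ⟨t, htS, htc⟩ := hinf.exists_subset_card_eq (N + 1)
    have := hN (insert v t) (hS _ (by simp) (by
      intro w hw
      rcases Finset.mem_insert.1 hw with rfl | hw
      · exact hv
      · exact htS hw)) (by simp)
    have h2 := Finset.card_le_card (Finset.subset_insert v t)
    omega
  refine ⟨hfin.toFinset, hS _ ⟨v, by simpa using hv⟩ (by simp), by simp⟩

lemma aux_coord {V : Type*} (v : V) : Continuous fun x : lp (fun _ : V => ℝ) 1 => x v := by
  refine LipschitzWith.continuous (K := 1) (LipschitzWith.of_dist_le_mul fun x y => ?_)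
  rw [dist_eq_norm, dist_eq_norm]
  simpa using lp.norm_apply_le_norm (p := 1) (by simp) (x - y) v

lemma aux_norm_of_nonneg {V : Type*} (x : lp (fun _ : V => ℝ) 1) (hx : ∀ v, 0 ≤ x v) :
    HasSum (fun v => x v) ‖x‖ := by
  rw [aux_norm]
  have := (aux_summable x).hasSum
  simpa [abs_of_nonneg (hx _)] using this

open Filter Topology in
lemma aux_complete {V : Type*} (K : SComplex V) (κ : ℝ) (hκ : 0 < κ)
    (hLFD : K.LocallyFiniteDimensional) : IsClosed (K.space κ) := by
  rw [← isSeqClosed_iff_isClosed]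
  intro x p hx hp
  have hc : ∀ v, Tendsto (fun n => x n v) atTop (𝓝 (p v)) := fun v =>
    ((aux_coord v).tendsto p).comp hp
  have hnn : ∀ v, 0 ≤ p v := fun v => ge_of_tendsto' (hc v) fun n => (hx n).1 v
  have hnorm : ‖p‖ = κ := by
    refine tendsto_nhds_unique hp.norm ?_
    have : (fun n => ‖x n‖) = fun _ => κ := by
      ext n
      exact (aux_norm_of_nonneg _ (hx n).1).unique (hx n).2.2
    rw [this]
    exact tendsto_const_nhds
  have hsum := aux_norm_of_nonneg p hnn
  rw [hnorm] at hsum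
  refine ⟨hnn, aux_face K hLFD {v | p v ≠ 0} ?_ ?_, hsum⟩
  · by_contra hcon
    rw [Set.not_nonempty_iff_eq_empty, Set.eq_empty_iff_forall_notMem] at hcon
    have h0 : ∀ v, p v = 0 := fun v => by simpa using hcon v
    simp only [h0] at hsum
    exact hκ.ne (hasSum_zero.unique hsum)
  · intro s hs hsS
    have : ∀ᶠ n in atTop, ∀ v ∈ s, x n v ≠ 0 := by
      rw [Filter.eventually_all_finset]
      intro v hv
      exact (hc v).eventually_ne (hsS v hv)
    obtain ⟨n, hn⟩ := this.exists
    obtain ⟨t, ht, hxt⟩ := (hx n).2.1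
    exact K.down_closed t ht s (fun v hv => hxt v (hn v hv)) hs

lemma aux_open_fun {Y : Type*} [MetricSpace Y] (W : Set Y) (hW : IsOpen W) :
    ∃ w : Y → ℝ, Continuous w ∧ (∀ y, 0 ≤ w y) ∧ (∀ y, w y ≠ 0 ↔ y ∈ W) := by
  by_cases hne : (Wᶜ).Nonempty
  · refine ⟨fun y => infDist y Wᶜ, continuous_infDist_pt _, fun y => infDist_nonneg, fun y => ?_⟩
    have := hW.isClosed_compl.mem_iff_infDist_zero hne (x := y)
    simp only [ne_eq, ← this, mem_compl_iff, not_not]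
  · refine ⟨fun _ => 1, continuous_const, fun _ => zero_le_one, fun y => ?_⟩
    rw [Set.not_nonempty_iff_eq_empty, compl_empty_iff] at hne
    simp [hne]

open Filter Topology in
lemma aux_ratio {Y : Type*} [MetricSpace Y] (A W : Set Y) (hA : IsClosed A) (hne : A.Nonempty)
    (hW : IsOpen W) (d : Y → ℝ) (hd : Continuous d) (hd0 : ∀ y ∈ A, y ∉ W → d y = 0) :
    ∃ h : Y → ℝ, Continuous h ∧ (∀ y, 0 ≤ h y) ∧ (∀ y, h y ≤ |d y|) ∧
      (∀ y ∈ A, h y = |d y|) ∧ ∀ y, h y ≠ 0 → y ∈ W := by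
  obtain ⟨w, hwc, hw0, hwW⟩ := aux_open_fun W hW
  have hA0 : ∀ y, 0 ≤ infDist y A := fun y => infDist_nonneg
  have hle : ∀ y, |d y| * (w y / (infDist y A + w y)) ≤ |d y| := fun y =>
    mul_le_of_le_one_right (abs_nonneg _)
      (div_le_one_of_le₀ (by linarith [hA0 y]) (by linarith [hA0 y, hw0 y]))
  have hnn : ∀ y, 0 ≤ |d y| * (w y / (infDist y A + w y)) := fun y => by
    have := hA0 y
    have := hw0 y
    positivity
  refine ⟨fun y => |d y| * (w y / (infDist y A + w y)), ?_, hnn, hle, ?_, ?_⟩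
  · rw [continuous_iff_continuousAt]
    intro y
    by_cases hy : infDist y A + w y = 0
    · have h1 : infDist y A = 0 := by linarith [hA0 y, hw0 y]
      have h2 : w y = 0 := by linarith [hA0 y, hw0 y]
      have h3 : d y = 0 := hd0 y ((hA.mem_iff_infDist_zero hne).2 h1)
        (fun h => (hwW y).2 h h2)
      have h4 : Tendsto (fun z => |d z|) (𝓝 y) (𝓝 0) := by
        have := (hd.abs).tendsto y
        simpa [h3] using this
      have h5 := squeeze_zero hnn hle h4
      rw [ContinuousAt]
      simpa [h3] using h5
    · exact hd.abs.continuousAt.mul (hwc.continuousAt.div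
        ((continuous_infDist_pt A).add hwc).continuousAt hy)
  · intro y hy
    simp only
    rw [infDist_zero_of_mem hy, zero_add]
    by_cases h : w y = 0
    · rw [hd0 y hy (fun h' => (hwW y).2 h' h)]
      simp
    · rw [div_self h, mul_one]
  · intro y hy
    refine (hwW y).1 fun h => hy ?_
    simp [h]

lemma aux_ane {V : Type*} (K : SComplex V) (κ : ℝ) (hκ : 0 < κ)
    (hLFD : K.LocallyFiniteDimensional) : IsANEInf.{u} (K.space κ) := by
  intro Y _ A hA f
  rcases A.eq_empty_or_nonempty with rfl | hne
  · exact ⟨∅, isOpen_empty, subset_rfl, ⟨fun y => y.2.elim,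
      continuous_iff_continuousAt.2 fun y => y.2.elim⟩, fun a ha => ha.elim⟩
  obtain ⟨D, hD, hDf⟩ := aux_dugundji A hA hne (fun a => (f a : lp (fun _ : V => ℝ) 1))
    (continuous_subtype_val.comp f.continuous)
  let W : V → Set Y := fun v => ⋃ (p : {p : Y × ℝ // p.1 ∈ A ∧
    ∀ b : A, dist (b : Y) p.1 < 2 * p.2 → (f b : lp (fun _ : V => ℝ) 1) v ≠ 0}), ball p.1.1 p.1.2
  have hWo : ∀ v, IsOpen (W v) := fun v => isOpen_iUnion fun p => isOpen_ball
  have hW0 : ∀ v, ∀ y ∈ A, y ∉ W v → D y v = 0 := by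
    intro v y hy hyW
    by_contra hne0
    rw [hDf ⟨y, hy⟩] at hne0
    apply hyW
    have hcont : Continuous fun b : A => (f b : lp (fun _ : V => ℝ) 1) v :=
      (aux_coord v).comp (continuous_subtype_val.comp f.continuous)
    have hev := hcont.continuousAt.eventually_ne hne0
    obtain ⟨ε, hε, H⟩ := Metric.eventually_nhds_iff.1 hev
    refine mem_iUnion.2 ⟨⟨(y, ε / 2), hy, fun b hb => H ?_⟩, ?_⟩
    · rw [Subtype.dist_eq]
      simp only at hb ⊢
      linarith
    · simp [hε]
  have hWface : ∀ y, ∀ s : Finset V, s.Nonempty → (∀ v ∈ s, y ∈ W v) → s ∈ K.faces := by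
    intro y s hs hsW
    have : ∀ v ∈ s, ∃ p : Y × ℝ, dist y p.1 < p.2 ∧ p.1 ∈ A ∧
        ∀ b : A, dist (b : Y) p.1 < 2 * p.2 → (f b : lp (fun _ : V => ℝ) 1) v ≠ 0 := by
      intro v hv
      obtain ⟨p, hp⟩ := mem_iUnion.1 (hsW v hv)
      exact ⟨p.1, hp, p.2⟩
    have hYne : Nonempty Y := ⟨y⟩
    choose! p hp1 hp2 hp3 using this
    obtain ⟨w, hw, hmin⟩ := s.exists_min_image (fun v => dist y (p v).1) hs
    obtain ⟨t, ht, hft⟩ := (f ⟨(p w).1, hp2 w hw⟩).2.2.1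
    refine K.down_closed t ht s (fun v hv => hft v (hp3 v hv _ ?_)) hs
    have h1 := hmin v hv
    have h2 := hp1 v hv
    have h3 := dist_triangle_left (p w).1 (p v).1 y
    simp only at h1 ⊢
    linarith
  choose h hhc hh0 hhle hhA hhW using fun v =>
    aux_ratio A (W v) hA hne (hWo v) (fun y => D y v) ((aux_coord v).comp hD) (hW0 v)
  have hmem : ∀ y, Memℓp (fun v => h v y) 1 := fun y => by
    refine memℓp_gen ?_
    simp only [ENNReal.toReal_one, Real.rpow_one, Real.norm_eq_abs]
    exact Summable.of_nonneg_of_le (fun v => abs_nonneg _)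
      (fun v => by rw [abs_of_nonneg (hh0 v y)]; exact hhle v y) (aux_summable (D y))
  let H : Y → lp (fun _ : V => ℝ) 1 := fun y => ⟨fun v => h v y, hmem y⟩
  have hHv : ∀ y v, H y v = h v y := fun y v => rfl
  have hHc : Continuous H := aux_dom D H hD (fun v => hhc v) (fun y v => by
    rw [hHv, abs_of_nonneg (hh0 v y)]; exact hhle v y)
  have hHA : ∀ a : A, H a = f a := fun a => by
    apply lp.ext
    funext v
    rw [hHv, hhA v a a.2, hDf a, abs_of_nonneg ((f a).2.1 v)]
  have hfn : ∀ a : A, ‖(f a : lp (fun _ : V => ℝ) 1)‖ = κ := fun a =>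
    (aux_norm_of_nonneg _ (f a).2.1).unique (f a).2.2.2
  have hGmem : ∀ y, H y ≠ 0 → (κ / ‖H y‖) • H y ∈ K.space κ := by
    intro y hy
    have hn : 0 < ‖H y‖ := norm_pos_iff.2 hy
    have hsm : ∀ v, ((κ / ‖H y‖) • H y) v = (κ / ‖H y‖) * h v y := fun v => rfl
    refine ⟨fun v => ?_, ?_, ?_⟩
    · rw [hsm]
      have := hh0 v y
      positivity
    · obtain ⟨s, hs, hsv⟩ := aux_face K hLFD {v | y ∈ W v} (by
        by_contra hcon
        apply hy
        apply lp.ext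
        funext v
        by_contra hv
        exact hcon ⟨v, hhW v y hv⟩) (hWface y)
      refine ⟨s, hs, fun v hv => hsv v (hhW v y fun h0 => hv ?_)⟩
      rw [hsm, h0, mul_zero]
    · have := (aux_norm_of_nonneg (H y) (fun v => hh0 v y)).mul_left (κ / ‖H y‖)
      rwa [div_mul_cancel₀ _ hn.ne'] at this
  refine ⟨{y | H y ≠ 0}, isOpen_ne_fun hHc continuous_const, ?_,
    ⟨fun y => ⟨(κ / ‖H y‖) • H y, hGmem y y.2⟩, ?_⟩, ?_⟩
  · intro a ha
    rw [mem_setOf_eq, ← norm_pos_iff, hHA ⟨a, ha⟩, hfn]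
    exact hκ
  · refine Continuous.subtype_mk ?_ _
    have h1 : Continuous fun y : {y | H y ≠ 0} => H y := hHc.comp continuous_subtype_val
    exact (continuous_const.div h1.norm fun y => norm_ne_zero_iff.2 y.2).smul h1
  · intro a ha
    apply Subtype.ext
    simp only [ContinuousMap.coe_mk]
    rw [hHA ⟨a, ha⟩, hfn, div_self hκ.ne', one_smul]

/-- A locally finite-dimensional polyhedron (with the metric topology)
is a complete metric space and an `ANE(∞)`. -/
theorem statement17 {V : Type*} (K : SComplex V) (κ : ℝ) (hκ : 0 < κ)
    (hLFD : K.LocallyFiniteDimensional) :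
    CompleteSpace (K.space κ) ∧ IsANEInf.{u} (K.space κ) := by
  exact ⟨(aux_complete K κ hκ hLFD).completeSpace_coe, aux_ane K κ hκ hLFD⟩
end
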